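/- arXiv:2107.14748 — 2 statements merged into one kernel-verified Lean document; each statement's English description precedes it below -/
import Mathlib

section
/- Let σ > 1, p ≥ 0 and δ > 0. Then sup_{T ∈ ℝ} ∫_{−δ}^{δ} |ζ(2σ + 2i(T+t)) / ζ(σ + i(T+t))|^p (δ − |t|) dt = ∫_{−δ}^{δ} |ζ(σ+it)|^p (δ − |t|) dt, and the same identity holds with the supremum replaced by limsup_{T → ∞}. -/
open Complex Real Filter MeasureTheory intervalIntegral

/-- The character `t ↦ exp (i ω t)` of the real line. -/
noncomputable def realChar (ω t : ℝ) : ℂ := cexp (ω * t * I)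

lemma realChar_eq (ω t : ℝ) : realChar ω t = cexp ((ω * t : ℝ) * I) := by
  simp [realChar]

lemma norm_realChar (ω t : ℝ) : ‖realChar ω t‖ = 1 := by
  rw [realChar_eq, norm_exp_ofReal_mul_I]

lemma continuous_realChar (ω : ℝ) : Continuous (realChar ω) := by
  unfold realChar; fun_prop

lemma realChar_add (ω η t : ℝ) : realChar (ω + η) t = realChar ω t * realChar η t := by
  simp only [realChar, ← Complex.exp_add]; congr 1; push_cast; ring

lemma realChar_add_right (ω s t : ℝ) : realChar ω (s + t) = realChar ω s * realChar ω t := by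
  simp only [realChar, ← Complex.exp_add]; congr 1; push_cast; ring

lemma realChar_zero (t : ℝ) : realChar 0 t = 1 := by simp [realChar]

lemma conj_realChar (ω t : ℝ) : (starRingEnd ℂ) (realChar ω t) = realChar (-ω) t := by
  simp [realChar, ← Complex.exp_conj]

/-- Bounded measurable complex functions on the real line. -/
def BoundedMeasurable (f : ℝ → ℂ) : Prop := Measurable f ∧ ∃ C : ℝ, ∀ t, ‖f t‖ ≤ C

namespace BoundedMeasurable

variable {f g : ℝ → ℂ}

lemma mul (hf : BoundedMeasurable f) (hg : BoundedMeasurable g) :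
    BoundedMeasurable (fun t => f t * g t) := by
  obtain ⟨hf, C, hC⟩ := hf
  obtain ⟨hg, D, hD⟩ := hg
  refine ⟨hf.mul hg, C * D, fun t => ?_⟩
  rw [norm_mul]
  exact mul_le_mul (hC t) (hD t) (norm_nonneg _) ((norm_nonneg _).trans (hC t))

lemma add (hf : BoundedMeasurable f) (hg : BoundedMeasurable g) :
    BoundedMeasurable (fun t => f t + g t) := by
  obtain ⟨hf, C, hC⟩ := hf
  obtain ⟨hg, D, hD⟩ := hg
  exact ⟨hf.add hg, C + D, fun t => (norm_add_le _ _).trans (add_le_add (hC t) (hD t))⟩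

lemma const (c : ℂ) : BoundedMeasurable (fun _ => c) :=
  ⟨measurable_const, ‖c‖, fun _ => le_rfl⟩

lemma char (ω : ℝ) : BoundedMeasurable (realChar ω) :=
  ⟨(continuous_realChar ω).measurable, 1, fun t => (norm_realChar ω t).le⟩

lemma conj (hf : BoundedMeasurable f) :
    BoundedMeasurable (fun t => (starRingEnd ℂ) (f t)) := by
  obtain ⟨hf, C, hC⟩ := hf
  exact ⟨Complex.continuous_conj.measurable.comp hf, C, fun t => by simpa using hC t⟩

lemma integrable (hf : BoundedMeasurable f) (ν : Measure ℝ) [IsFiniteMeasure ν] :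
    Integrable f ν := by
  obtain ⟨hf, C, hC⟩ := hf
  exact Integrable.of_bound hf.aestronglyMeasurable C (Eventually.of_forall hC)

end BoundedMeasurable

/-- Every Fourier coefficient of `u` with respect to `ν` is at most, in absolute value, the
corresponding coefficient of `v`. -/
structure FourierDominated (ν : Measure ℝ) (u v : ℝ → ℂ) : Prop where
  left : BoundedMeasurable u
  right : BoundedMeasurable v
  norm_le : ∀ ω, ‖∫ t, u t * realChar ω t ∂ν‖ ≤ (∫ t, v t * realChar ω t ∂ν).re

/-- Multiplication by the pair `(f, g)` preserves domination of Fourier coefficients. -/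
structure Majorized (ν : Measure ℝ) (f g : ℝ → ℂ) : Prop where
  left : BoundedMeasurable f
  right : BoundedMeasurable g
  mul_norm_le : ∀ u v, FourierDominated ν u v → ∀ ω,
    ‖∫ t, f t * u t * realChar ω t ∂ν‖ ≤ (∫ t, g t * v t * realChar ω t ∂ν).re

section

variable {ν : Measure ℝ} {u v f g f' g' : ℝ → ℂ}

lemma FourierDominated.conj (h : FourierDominated ν u v) :
    FourierDominated ν (fun t => (starRingEnd ℂ) (u t)) (fun t => (starRingEnd ℂ) (v t)) := by
  refine ⟨h.left.conj, h.right.conj, fun ω => ?_⟩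
  have key (w : ℝ → ℂ) : ∫ t, (starRingEnd ℂ) (w t) * realChar ω t ∂ν =
      (starRingEnd ℂ) (∫ t, w t * realChar (-ω) t ∂ν) := by
    rw [← integral_conj]
    simp [conj_realChar]
  rw [key, key, norm_conj, conj_re]
  exact h.norm_le (-ω)

lemma Majorized.dominated (h : Majorized ν f g) (huv : FourierDominated ν u v) :
    FourierDominated ν (fun t => f t * u t) (fun t => g t * v t) :=
  ⟨h.left.mul huv.left, h.right.mul huv.right, h.mul_norm_le u v huv⟩

lemma Majorized.mul (h : Majorized ν f g) (h' : Majorized ν f' g') :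
    Majorized ν (fun t => f t * f' t) (fun t => g t * g' t) := by
  refine ⟨h.left.mul h'.left, h.right.mul h'.right, fun u v huv ω => ?_⟩
  simpa only [mul_assoc] using h.mul_norm_le _ _ (h'.dominated huv) ω

lemma Majorized.conj (h : Majorized ν f g) :
    Majorized ν (fun t => (starRingEnd ℂ) (f t)) (fun t => (starRingEnd ℂ) (g t)) := by
  refine ⟨h.left.conj, h.right.conj, fun u v huv ω => ?_⟩
  simpa using (h.dominated huv.conj).conj.norm_le ω

lemma Majorized.char {c : ℂ} {b : ℝ} (hcb : ‖c‖ ≤ b) (η : ℝ) :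
    Majorized ν (fun t => c * realChar η t) (fun t => b * realChar η t) := by
  refine ⟨(BoundedMeasurable.const c).mul (.char η), (BoundedMeasurable.const b).mul (.char η),
    fun u v huv ω => ?_⟩
  have key (a : ℂ) (w : ℝ → ℂ) : ∫ t, a * realChar η t * w t * realChar ω t ∂ν =
      a * ∫ t, w t * realChar (η + ω) t ∂ν := by
    rw [← MeasureTheory.integral_const_mul]
    congr 1; ext t; rw [realChar_add]; ring
  rw [key, key, norm_mul, re_ofReal_mul]
  exact mul_le_mul hcb (huv.norm_le _) (norm_nonneg _) ((norm_nonneg _).trans hcb)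

lemma Majorized.const {c : ℂ} {b : ℝ} (hcb : ‖c‖ ≤ b) :
    Majorized ν (fun _ => c) (fun _ => b) := by
  simpa [realChar_zero] using Majorized.char (ν := ν) hcb 0

lemma Majorized.pow (h : Majorized ν f g) (n : ℕ) :
    Majorized ν (fun t => f t ^ n) (fun t => g t ^ n) := by
  induction n with
  | zero => simpa using Majorized.const (ν := ν) (c := 1) (b := 1) (by simp)
  | succ n ih => simpa only [pow_succ] using ih.mul h

lemma Majorized.integral_le {a b : ℝ → ℝ} (h : Majorized ν (fun t => a t) (fun t => b t))
    (hν : ∀ ω, ‖∫ t, realChar ω t ∂ν‖ ≤ (∫ t, realChar ω t ∂ν).re) :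
    ∫ t, a t ∂ν ≤ ∫ t, b t ∂ν := by
  have := h.mul_norm_le (fun _ => 1) (fun _ => 1) ⟨.const 1, .const 1, by simpa using hν⟩ 0
  simp only [realChar_zero, mul_one] at this
  rw [integral_complex_ofReal, integral_complex_ofReal, norm_real, ofReal_re] at this
  exact (le_abs_self _).trans this

variable [IsFiniteMeasure ν]

lemma Majorized.add (h : Majorized ν f g) (h' : Majorized ν f' g') :
    Majorized ν (fun t => f t + f' t) (fun t => g t + g' t) := by
  refine ⟨h.left.add h'.left, h.right.add h'.right, fun u v huv ω => ?_⟩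
  have key {a b w : ℝ → ℂ} (ha : BoundedMeasurable a) (hb : BoundedMeasurable b)
      (hw : BoundedMeasurable w) : ∫ t, (a t + b t) * w t * realChar ω t ∂ν =
        ∫ t, a t * w t * realChar ω t ∂ν + ∫ t, b t * w t * realChar ω t ∂ν := by
    rw [← integral_add (((ha.mul hw).mul (.char ω)).integrable ν)
      (((hb.mul hw).mul (.char ω)).integrable ν)]
    simp only [add_mul]
  rw [key h.left h'.left huv.left, key h.right h'.right huv.right, add_re]
  exact (norm_add_le _ _).trans
    (add_le_add (h.mul_norm_le u v huv ω) (h'.mul_norm_le u v huv ω))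

lemma Majorized.finset_sum {ι : Type*} {F G : ι → ℝ → ℂ} (h : ∀ i, Majorized ν (F i) (G i))
    (s : Finset ι) : Majorized ν (fun t => ∑ i ∈ s, F i t) (fun t => ∑ i ∈ s, G i t) := by
  classical
  induction s using Finset.induction_on with
  | empty => simpa using Majorized.const (ν := ν) (c := 0) (b := 0) (by simp)
  | insert a s ha ih =>
    simp only [Finset.sum_insert ha]
    exact (h a).add ih

lemma BoundedMeasurable.of_tendsto {ι : Type*} {l : Filter ι} [l.NeBot]
    [l.IsCountablyGenerated] {F : ι → ℝ → ℂ} (hF : ∀ i, Measurable (F i)) {C : ℝ}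
    (hC : ∀ i t, ‖F i t‖ ≤ C) (hlim : ∀ t, Tendsto (fun i => F i t) l (nhds (f t))) :
    BoundedMeasurable f :=
  ⟨measurable_of_tendsto_metrizable' l hF (tendsto_pi_nhds.2 hlim), C, fun t =>
    le_of_tendsto (hlim t).norm (Eventually.of_forall fun i => hC i t)⟩

lemma tendsto_integral_of_bounded {ι : Type*} {l : Filter ι} [l.IsCountablyGenerated]
    {F : ι → ℝ → ℂ} (hF : ∀ i, Measurable (F i)) {C : ℝ} (hC : ∀ i t, ‖F i t‖ ≤ C)
    (hlim : ∀ t, Tendsto (fun i => F i t) l (nhds (f t))) (hu : BoundedMeasurable u) :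
    Tendsto (fun i => ∫ t, F i t * u t ∂ν) l (nhds (∫ t, f t * u t ∂ν)) := by
  obtain ⟨hu, D, hD⟩ := hu
  refine tendsto_integral_filter_of_dominated_convergence (fun _ => C * D)
    (Eventually.of_forall fun i => ((hF i).mul hu).aestronglyMeasurable)
    (Eventually.of_forall fun i => Eventually.of_forall fun t => ?_) (integrable_const _)
    (Eventually.of_forall fun t => (hlim t).mul_const _)
  rw [norm_mul]
  exact mul_le_mul (hC i t) (hD t) (norm_nonneg _) ((norm_nonneg _).trans (hC i t))

lemma Majorized.of_tendsto {ι : Type*} {l : Filter ι} [l.NeBot] [l.IsCountablyGenerated]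
    {F G : ι → ℝ → ℂ} (h : ∀ i, Majorized ν (F i) (G i)) {C : ℝ}
    (hF : ∀ i t, ‖F i t‖ ≤ C) (hG : ∀ i t, ‖G i t‖ ≤ C)
    (hf : ∀ t, Tendsto (fun i => F i t) l (nhds (f t)))
    (hg : ∀ t, Tendsto (fun i => G i t) l (nhds (g t))) : Majorized ν f g := by
  refine ⟨.of_tendsto (fun i => (h i).left.1) hF hf, .of_tendsto (fun i => (h i).right.1) hG hg,
    fun u v huv ω => ?_⟩
  have h1 := tendsto_integral_of_bounded (ν := ν) (fun i => (h i).left.1) hF hf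
    (huv.left.mul (.char ω))
  have h2 := tendsto_integral_of_bounded (ν := ν) (fun i => (h i).right.1) hG hg
    (huv.right.mul (.char ω))
  simp only [← mul_assoc] at h1 h2
  exact le_of_tendsto_of_tendsto' h1.norm ((continuous_re.tendsto _).comp h2)
    fun i => (h i).mul_norm_le u v huv ω

lemma Majorized.hasSum {ι : Type*} [Countable ι] {F G : ι → ℝ → ℂ}
    (h : ∀ i, Majorized ν (F i) (G i)) {c : ι → ℝ} (hc : Summable c)
    (hF : ∀ i t, ‖F i t‖ ≤ c i) (hG : ∀ i t, ‖G i t‖ ≤ c i)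
    (hf : ∀ t, HasSum (fun i => F i t) (f t)) (hg : ∀ t, HasSum (fun i => G i t) (g t)) :
    Majorized ν f g := by
  have hc0 (i : ι) : 0 ≤ c i := (norm_nonneg _).trans (hF i 0)
  refine Majorized.of_tendsto (l := atTop) (fun s : Finset ι => Majorized.finset_sum h s)
    (C := ∑' i, c i) (fun s t => ?_) (fun s t => ?_) hf hg
  · exact ((norm_sum_le _ _).trans (Finset.sum_le_sum fun i _ => hF i t)).trans
      (hc.sum_le_tsum s fun i _ => hc0 i)
  · exact ((norm_sum_le _ _).trans (Finset.sum_le_sum fun i _ => hG i t)).trans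
      (hc.sum_le_tsum s fun i _ => hc0 i)

lemma Majorized.exp (h : Majorized ν f g) :
    Majorized ν (fun t => cexp (f t)) (fun t => cexp (g t)) := by
  obtain ⟨K, hf, hg⟩ : ∃ K : ℝ, (∀ t, ‖f t‖ ≤ K) ∧ ∀ t, ‖g t‖ ≤ K := by
    obtain ⟨C, hC⟩ := h.left.2
    obtain ⟨D, hD⟩ := h.right.2
    exact ⟨max C D, fun t => (hC t).trans (le_max_left _ _),
      fun t => (hD t).trans (le_max_right _ _)⟩
  have key {w : ℝ → ℂ} (hw : ∀ t, ‖w t‖ ≤ K) (n : ℕ) (t : ℝ) :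
      ‖((n.factorial : ℝ)⁻¹ : ℝ) * w t ^ n‖ ≤ K ^ n / n.factorial := by
    rw [norm_mul, norm_pow, div_eq_inv_mul]
    have : ‖(((n.factorial : ℝ)⁻¹ : ℝ) : ℂ)‖ = (n.factorial : ℝ)⁻¹ := by simp
    rw [this]
    gcongr
    exact hw t
  have hs (z : ℂ) : HasSum (fun n : ℕ => (((n.factorial : ℝ)⁻¹ : ℝ) : ℂ) * z ^ n) (cexp z) := by
    have := NormedSpace.expSeries_div_hasSum_exp (𝔸 := ℂ) z
    rw [← Complex.exp_eq_exp_ℂ] at this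
    simpa [div_eq_inv_mul] using this
  refine Majorized.hasSum (F := fun (n : ℕ) t => ((n.factorial : ℝ)⁻¹ : ℝ) * f t ^ n)
    (G := fun (n : ℕ) t => ((n.factorial : ℝ)⁻¹ : ℝ) * g t ^ n) (fun n => ?_)
    (Real.summable_pow_div_factorial (K)) (key hf) (key hg) (fun t => hs _) (fun t => hs _)
  exact (Majorized.const (by simp)).mul (h.pow n)

lemma Majorized.neg_log_one_sub {r : ℝ} (hr0 : 0 ≤ r) (hr : r < 1) {c : ℂ} (hc : ‖c‖ ≤ 1)
    (η : ℝ) : Majorized ν (fun t => -Complex.log (1 - c * (r * realChar η t)))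
      (fun t => -Complex.log (1 - r * realChar η t)) := by
  have hle (w : ℂ) (hw : ‖w‖ ≤ 1) (t : ℝ) : ‖w * (r * realChar η t)‖ ≤ r := by
    rw [norm_mul, norm_mul, norm_realChar, mul_one, norm_real, norm_of_nonneg hr0]
    exact mul_le_of_le_one_left hr0 hw
  have hM : Majorized ν (fun t => c * (r * realChar η t)) (fun t => r * realChar η t) := by
    simpa using (Majorized.const (ν := ν) (b := 1) hc).mul
      (Majorized.char (c := (r : ℂ)) (b := r) (by simp [abs_of_nonneg hr0]) η)
  have key {w : ℂ} (hw : ‖w‖ ≤ r) (n : ℕ) : ‖(((n : ℝ)⁻¹ : ℝ) : ℂ) * w ^ n‖ ≤ r ^ n := by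
    rw [norm_mul, norm_pow, norm_real, norm_of_nonneg (by positivity)]
    have h1 : (n : ℝ)⁻¹ ≤ 1 := Nat.cast_inv_le_one n
    calc (n : ℝ)⁻¹ * ‖w‖ ^ n ≤ 1 * r ^ n := by gcongr
      _ = r ^ n := one_mul _
  have hs {w : ℂ} (hw : ‖w‖ ≤ r) :
      HasSum (fun n : ℕ => (((n : ℝ)⁻¹ : ℝ) : ℂ) * w ^ n) (-Complex.log (1 - w)) := by
    simpa [div_eq_inv_mul] using Complex.hasSum_taylorSeries_neg_log (hw.trans_lt hr)
  have hle' (t : ℝ) : ‖r * realChar η t‖ ≤ r := by simpa using hle 1 (by simp) t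
  exact Majorized.hasSum (F := fun (n : ℕ) t => ((n : ℝ)⁻¹ : ℝ) * (c * (r * realChar η t)) ^ n)
    (G := fun (n : ℕ) t => ((n : ℝ)⁻¹ : ℝ) * (r * realChar η t) ^ n)
    (fun n => (Majorized.const (by simp)).mul (hM.pow n))
    (summable_geometric_of_lt_one hr0 hr) (fun n t => key (hle c hc t) n)
    (fun n t => key (hle' t) n) (fun t => hs (hle c hc t)) (fun t => hs (hle' t))

lemma Majorized.exp_re (h : Majorized ν f g) {p : ℝ} (hp : 0 ≤ p) :
    Majorized ν (fun t => (rexp (p * (f t).re) : ℝ)) (fun t => (rexp (p * (g t).re) : ℝ)) := by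
  have key (z : ℂ) : ((rexp (p * z.re) : ℝ) : ℂ) =
      cexp ((p / 2 : ℝ) * (z + (starRingEnd ℂ) z)) := by
    rw [add_conj]; push_cast; congr 1; ring
  simp only [key]
  exact ((Majorized.const (by simp [abs_of_nonneg hp])).mul (h.add h.conj)).exp

end

/-- The measure on `(-δ, δ]` with density `δ - |t|`. -/
noncomputable def triangleMeasure (δ : ℝ) : Measure ℝ :=
  (volume.restrict (Set.Ioc (-δ) δ)).withDensity fun t => ((δ - |t|).toNNReal : ENNReal)

instance isFiniteMeasure_triangleMeasure (δ : ℝ) : IsFiniteMeasure (triangleMeasure δ) := by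
  refine isFiniteMeasure_withDensity_ofReal (f := fun t => δ - |t|) ?_
  exact ((Continuous.integrableOn_Icc (by fun_prop)).mono_set
    (Set.Ioc_subset_Icc_self (a := -δ) (b := δ))).2

lemma integral_triangleMeasure {E : Type*} [NormedAddCommGroup E] [NormedSpace ℝ E] {δ : ℝ}
    (hδ : 0 < δ) (f : ℝ → E) :
    ∫ t, f t ∂(triangleMeasure δ) = ∫ t in (-δ)..δ, (δ - |t|) • f t := by
  rw [triangleMeasure, integral_withDensity_eq_integral_smul (by fun_prop),
    intervalIntegral.integral_of_le (by linarith)]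
  refine setIntegral_congr_fun measurableSet_Ioc fun t ht => ?_
  have : 0 ≤ δ - |t| := sub_nonneg.2 (abs_le.2 ⟨ht.1.le, ht.2⟩)
  simp [NNReal.smul_def, Real.coe_toNNReal _ this]

lemma integral_sub_mul_cos_nonneg (δ ω : ℝ) (hδ : 0 < δ) :
    0 ≤ ∫ t in (0 : ℝ)..δ, (δ - t) * (2 * Real.cos (ω * t)) := by
  rcases eq_or_ne ω 0 with rfl | hω
  · refine intervalIntegral.integral_nonneg hδ.le fun t ht => ?_
    have := ht.2
    simp; linarith
  · have hderiv (t : ℝ) : HasDerivAt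
        (fun t => 2 * ((δ - t) * (Real.sin (ω * t) / ω) - Real.cos (ω * t) / ω ^ 2))
        ((δ - t) * (2 * Real.cos (ω * t))) t := by
      have h0 : HasDerivAt (fun t => ω * t) ω t := by simpa using (hasDerivAt_id t).const_mul ω
      have h1 := (h0.sin.div_const ω)
      have h2 := (h0.cos.div_const (ω ^ 2))
      have h3 := (hasDerivAt_id t).const_sub δ
      refine (((h3.mul h1).sub h2).const_mul 2).congr_deriv ?_
      simp only [id]
      field_simp
      ring
    rw [intervalIntegral.integral_eq_sub_of_hasDerivAt (fun t _ => hderiv t)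
      (Continuous.intervalIntegrable (by fun_prop) _ _)]
    have h1 : 0 ≤ (1 - Real.cos (ω * δ)) / ω ^ 2 :=
      div_nonneg (sub_nonneg.2 (Real.cos_le_one _)) (sq_nonneg _)
    simp
    rw [sub_div, one_div] at h1
    linarith

lemma norm_integral_realChar_triangleMeasure_le {δ : ℝ} (hδ : 0 < δ) (ω : ℝ) :
    ‖∫ t, realChar ω t ∂(triangleMeasure δ)‖ ≤ (∫ t, realChar ω t ∂(triangleMeasure δ)).re := by
  have key : ∫ t, realChar ω t ∂(triangleMeasure δ) =
      ((∫ t in (0 : ℝ)..δ, (δ - t) * (2 * Real.cos (ω * t)) : ℝ) : ℂ) := by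
    have hc : Continuous fun t : ℝ => (δ - |t|) • realChar ω t :=
      (by fun_prop : Continuous fun t : ℝ => δ - |t|).smul (continuous_realChar ω)
    have hc' : Continuous fun t : ℝ => (δ - |t|) • realChar ω (-t) :=
      (by fun_prop : Continuous fun t : ℝ => δ - |t|).smul
        ((continuous_realChar ω).comp continuous_neg)
    have hneg := intervalIntegral.integral_comp_neg (a := 0) (b := δ)
      (fun t : ℝ => (δ - |t|) • realChar ω t)
    simp only [abs_neg, neg_zero] at hneg
    rw [integral_triangleMeasure hδ, ← intervalIntegral.integral_add_adjacent_intervals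
      (hc.intervalIntegrable (-δ) 0) (hc.intervalIntegrable 0 δ), ← hneg,
      ← intervalIntegral.integral_add (hc'.intervalIntegrable _ _) (hc.intervalIntegrable _ _),
      ← intervalIntegral.integral_ofReal]
    refine intervalIntegral.integral_congr fun t ht => ?_
    rw [Set.uIcc_of_le hδ.le] at ht
    simp only [abs_of_nonneg ht.1, realChar, real_smul]
    push_cast
    rw [Complex.two_cos]
    ring_nf
  rw [key, norm_real, ofReal_re, norm_of_nonneg (integral_sub_mul_cos_nonneg δ ω hδ)]

lemma norm_integral_realChar_le {θ : ℝ} (hθ : θ ≠ 0) (a b : ℝ) :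
    ‖∫ t in a..b, realChar θ t‖ ≤ 2 / |θ| := by
  have h (t : ℝ) : realChar θ t = cexp (θ * I * t) := by
    unfold realChar; congr 1; ring
  have hθ' : (θ : ℂ) * I ≠ 0 := by simp [hθ]
  simp_rw [h]
  rw [integral_exp_mul_complex hθ', ← h, ← h, norm_div]
  have h2 : ‖realChar θ b - realChar θ a‖ ≤ 2 := by
    refine (norm_sub_le _ _).trans ?_
    rw [norm_realChar, norm_realChar]; norm_num
  simpa using div_le_div_of_nonneg_right h2 (abs_nonneg θ)

lemma norm_coeff_le_of_norm_sum_realChar_le {κ : Type*} (s : Finset κ) (A : κ → ℂ)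
    (θ : κ → ℝ) {e₀ : κ} (he₀ : e₀ ∈ s) (h₀ : θ e₀ = 0) (hθ : ∀ e ∈ s, θ e = 0 → e = e₀)
    {B T₀ : ℝ} (hB : ∀ T ≥ T₀, ‖∑ e ∈ s, A e * realChar (θ e) T‖ ≤ B) : ‖A e₀‖ ≤ B := by
  classical
  set K : ℝ := ∑ e ∈ s.erase e₀, ‖A e‖ * (2 / |θ e|) with hK
  have main (X : ℝ) (hX : 0 < X) : ‖A e₀‖ * X ≤ B * X + K := by
    have h1 : ‖∫ T in T₀..(T₀ + X), ∑ e ∈ s, A e * realChar (θ e) T‖ ≤ B * X := by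
      have := intervalIntegral.norm_integral_le_of_norm_le_const (a := T₀) (b := T₀ + X)
        (f := fun T => ∑ e ∈ s, A e * realChar (θ e) T) (C := B) (fun T hT => by
          rw [Set.uIoc_of_le (by linarith)] at hT
          exact hB T hT.1.le)
      simpa [abs_of_pos hX] using this
    rw [intervalIntegral.integral_finsetSum (fun e _ =>
      ((continuous_realChar (θ e)).const_mul (A e)).intervalIntegrable _ _),
      ← Finset.add_sum_erase s _ he₀] at h1
    simp only [intervalIntegral.integral_const_mul, h₀, realChar_zero] at h1
    have h2 : ‖∑ e ∈ s.erase e₀, A e * ∫ T in T₀..(T₀ + X), realChar (θ e) T‖ ≤ K := by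
      refine (norm_sum_le _ _).trans (Finset.sum_le_sum fun e he => ?_)
      rw [norm_mul]
      gcongr
      exact norm_integral_realChar_le (fun h => (Finset.mem_erase.1 he).1
        (hθ e (Finset.mem_erase.1 he).2 h)) _ _
    have h3 : ‖A e₀ * ∫ _ in T₀..(T₀ + X), (1 : ℂ)‖ = ‖A e₀‖ * X := by
      simp [abs_of_pos hX]
    rw [← h3]
    refine (norm_le_add_norm_add _ _).trans (add_le_add h1 h2)
  by_contra! hlt
  have hK0 : 0 ≤ K := Finset.sum_nonneg fun e _ => by positivity
  have hd : 0 < ‖A e₀‖ - B := sub_pos.2 hlt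
  have := main ((K + 1) / (‖A e₀‖ - B)) (by positivity)
  have h4 : (‖A e₀‖ - B) * ((K + 1) / (‖A e₀‖ - B)) = K + 1 := by field_simp
  linarith

lemma norm_one_sub_pow_eq_sum {z : ℂ} (hz : ‖z‖ = 1) (k : ℕ) :
    (((‖1 - z‖ ^ 2 / 4) ^ k : ℝ) : ℂ) = ∑ e ∈ Finset.range (2 * k + 1),
      ((4 : ℂ)⁻¹ ^ k * (-1) ^ k * (-1) ^ e * (2 * k).choose e) *
        (z ^ e * (starRingEnd ℂ) z ^ k) := by
  have hzz : z * (starRingEnd ℂ) z = 1 := by rw [mul_conj, normSq_eq_norm_sq, hz]; simp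
  have h1 : ((‖1 - z‖ ^ 2 : ℝ) : ℂ) = (1 - z) ^ 2 * (-(starRingEnd ℂ) z) := by
    rw [← normSq_eq_norm_sq, ← mul_conj]
    simp only [map_sub, map_one]
    linear_combination (-(1 - z)) * hzz
  have h2 : (1 - z) ^ (2 * k) = ∑ e ∈ Finset.range (2 * k + 1),
      (-1) ^ e * z ^ e * (2 * k).choose e := by
    rw [sub_eq_neg_add, add_pow]
    refine Finset.sum_congr rfl fun e _ => ?_
    rw [one_pow, neg_pow z]; ring
  push_cast at h1 ⊢
  rw [h1, div_eq_mul_inv, mul_pow, mul_pow, ← pow_mul, h2, neg_pow, Finset.sum_mul,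
    Finset.sum_mul]
  exact Finset.sum_congr rfl fun e _ => by ring

lemma realChar_pow (ω : ℝ) (n : ℕ) (t : ℝ) : realChar ω t ^ n = realChar (n * ω) t := by
  simp only [realChar, ← Complex.exp_nat_mul]; congr 1; push_cast; ring

lemma prod_realChar {ι : Type*} (s : Finset ι) (ω : ι → ℝ) (t : ℝ) :
    ∏ i ∈ s, realChar (ω i) t = realChar (∑ i ∈ s, ω i) t := by
  simp only [realChar, ← Complex.exp_sum]; congr 1; push_cast
  rw [Finset.sum_mul, Finset.sum_mul]

/-- An inhomogeneous Kronecker approximation theorem: if the natural number combinations of the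
frequencies `ω i` are pairwise distinct, then all `exp (i ω i T)` are simultaneously close to `-1`
for arbitrarily large `T`. -/
lemma frequently_norm_realChar_add_one_lt {ι : Type*} [Fintype ι] (ω : ι → ℝ)
    (hω : ∀ e e' : ι → ℕ, ∑ i, e i * ω i = ∑ i, e' i * ω i → e = e') {ε : ℝ} (hε : 0 < ε) :
    ∃ᶠ T : ℝ in atTop, ∀ i, ‖realChar (ω i) T + 1‖ < ε := by
  classical
  intro hev
  obtain ⟨T₀, hT₀⟩ := eventually_atTop.1 hev
  simp only [not_forall, not_lt] at hT₀
  set q : ℝ := 1 - ε ^ 2 / 4 with hq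
  set y : ι → ℝ → ℝ := fun i T => ‖1 - realChar (ω i) T‖ ^ 2 / 4 with hy
  have hpar (i : ι) (T : ℝ) : y i T = 1 - ‖realChar (ω i) T + 1‖ ^ 2 / 4 := by
    have := parallelogram_law_with_norm ℝ (1 : ℂ) (realChar (ω i) T)
    rw [norm_realChar, norm_one, add_comm (1 : ℂ)] at this
    simp only [hy]
    linarith
  have hy0 (i : ι) (T : ℝ) : 0 ≤ y i T := by positivity
  have hy1 (i : ι) (T : ℝ) : y i T ≤ 1 := by rw [hpar]; linarith [sq_nonneg ‖realChar (ω i) T + 1‖]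
  have hprod (T : ℝ) (hT : T ≥ T₀) : ∏ i, y i T ≤ q := by
    obtain ⟨i, hi⟩ := hT₀ T hT
    have h1 : y i T ≤ q := by
      rw [hpar, hq]
      have : ε ^ 2 ≤ ‖realChar (ω i) T + 1‖ ^ 2 := by gcongr
      linarith
    rw [← Finset.mul_prod_erase _ _ (Finset.mem_univ i)]
    exact (mul_le_of_le_one_right (hy0 i T)
      (Finset.prod_le_one (fun j _ => hy0 j T) fun j _ => hy1 j T)).trans h1
  have hq0 : 0 ≤ q := (Finset.prod_nonneg fun i _ => hy0 i T₀).trans (hprod T₀ le_rfl)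
  have hq1 : q < 1 := by
    have : 0 < ε ^ 2 := by positivity
    linarith
  have hexp (k : ℕ) (T : ℝ) : (((∏ i, y i T) ^ k : ℝ) : ℂ) =
      ∑ e ∈ Fintype.piFinset fun _ : ι => Finset.range (2 * k + 1),
        (∏ i, ((4 : ℂ)⁻¹ ^ k * (-1) ^ k * (-1) ^ e i * (2 * k).choose (e i))) *
          realChar (∑ i, e i * ω i - ∑ i, k * ω i) T := by
    rw [← Finset.prod_pow, ofReal_prod]
    simp only [hy, norm_one_sub_pow_eq_sum (norm_realChar _ T)]
    rw [Finset.prod_univ_sum]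
    refine Finset.sum_congr rfl fun e _ => ?_
    rw [Finset.prod_mul_distrib]
    congr 1
    rw [← Finset.sum_sub_distrib, ← prod_realChar]
    refine Finset.prod_congr rfl fun i _ => ?_
    rw [conj_realChar, realChar_pow, realChar_pow, ← realChar_add]
    congr 1; ring
  have hbound (k : ℕ) : ((k.centralBinom : ℝ) / 4 ^ k) ^ Fintype.card ι ≤ q ^ k := by
    have := norm_coeff_le_of_norm_sum_realChar_le
      (Fintype.piFinset fun _ : ι => Finset.range (2 * k + 1))
      (fun e => ∏ i, ((4 : ℂ)⁻¹ ^ k * (-1) ^ k * (-1) ^ e i * (2 * k).choose (e i)))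
      (fun e => ∑ i, e i * ω i - ∑ i, k * ω i) (e₀ := fun _ => k)
      (by simp [Fintype.mem_piFinset]; omega) (by simp)
      (fun e _ he => hω e (fun _ => k) (sub_eq_zero.1 he)) (B := q ^ k) (T₀ := T₀)
      (fun T hT => by
        rw [← hexp k T, norm_real, norm_of_nonneg
          (pow_nonneg (Finset.prod_nonneg fun i _ => hy0 i T) k)]
        exact pow_le_pow_left₀ (Finset.prod_nonneg fun i _ => hy0 i T) (hprod T hT) k)
    refine le_of_eq_of_le ?_ this
    simp [Nat.centralBinom_eq_two_mul_choose, div_eq_inv_mul]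
  have hlim := tendsto_pow_const_mul_const_pow_of_lt_one (Fintype.card ι) hq0 hq1
  have hev := (hlim.eventually_lt_const
    (show (0 : ℝ) < (1 / 2) ^ Fintype.card ι by positivity)).and (eventually_gt_atTop 0)
  obtain ⟨k, hk, hk0⟩ := hev.exists
  have hk0' : (0 : ℝ) < k := by exact_mod_cast hk0
  have h4 : (4 : ℝ) ^ k ≤ 2 * k * k.centralBinom := by
    exact_mod_cast Nat.four_pow_le_two_mul_self_mul_centralBinom k hk0
  have h5 : 1 / 2 ≤ k * ((k.centralBinom : ℝ) / 4 ^ k) := by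
    rw [← mul_div_assoc, le_div_iff₀ (by positivity)]
    linarith
  have h6 : (1 / 2 : ℝ) ^ Fintype.card ι ≤ k ^ Fintype.card ι * q ^ k :=
    calc (1 / 2 : ℝ) ^ Fintype.card ι
        ≤ (k * ((k.centralBinom : ℝ) / 4 ^ k)) ^ Fintype.card ι := by gcongr
      _ = k ^ Fintype.card ι * ((k.centralBinom : ℝ) / 4 ^ k) ^ Fintype.card ι := mul_pow _ _ _
      _ ≤ k ^ Fintype.card ι * q ^ k := by gcongr; exact hbound k
  linarith

lemma eq_of_sum_mul_log_prime_eq {ι : Type*} [Fintype ι] {P : ι → ℕ} (hP : ∀ i, (P i).Prime)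
    (hinj : Function.Injective P) {e e' : ι → ℕ}
    (h : ∑ i, e i * Real.log (P i) = ∑ i, e' i * Real.log (P i)) : e = e' := by
  classical
  have hpos (f : ι → ℕ) (i : ι) : 0 < P i ^ f i := pow_pos (hP i).pos _
  have key (f : ι → ℕ) : ∑ i, f i * Real.log (P i) = Real.log ((∏ i, P i ^ f i : ℕ) : ℝ) := by
    push_cast
    rw [Real.log_prod fun i _ => by exact_mod_cast (hpos f i).ne']
    simp [Real.log_pow]
  have hmem (f : ι → ℕ) : ((∏ i, P i ^ f i : ℕ) : ℝ) ∈ Set.Ioi 0 :=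
    Set.mem_Ioi.2 (Nat.cast_pos.2 (Finset.prod_pos fun i _ => hpos f i))
  have hfac (f : ι → ℕ) (j : ι) : (∏ i, P i ^ f i).factorization (P j) = f j := by
    rw [Nat.factorization_prod fun i _ => (hpos f i).ne']
    simp only [Nat.Prime.factorization_pow (hP _), Finsupp.finsetSum_apply]
    rw [Finset.sum_eq_single j]
    · simp
    · intro i _ hij
      exact Finsupp.single_eq_of_ne fun h => hij (hinj h.symm)
    · simp
  rw [key, key] at h
  have h' : ∏ i, P i ^ e i = ∏ i, P i ^ e' i := by
    exact_mod_cast Real.log_injOn_pos (hmem e) (hmem e') h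
  ext j
  rw [← hfac e j, h', hfac]

/-- There are arbitrarily large shifts `T` for which `p ^ (-iT)` is close to `-1` for every
given prime `p`. -/
lemma exists_seq_realChar_log_prime_tendsto : ∃ T : ℕ → ℝ, Tendsto T atTop atTop ∧
    ∀ p : Nat.Primes, Tendsto (fun n => realChar (-Real.log p) (T n)) atTop (nhds (-1)) := by
  classical
  have h (n : ℕ) : ∃ T : ℝ, (n : ℝ) ≤ T ∧ ∀ p : Nat.Primes, (p : ℕ) ≤ n →
      ‖realChar (Real.log p) T + 1‖ < 1 / ((n : ℝ) + 1) := by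
    have hfin : {p : Nat.Primes | (p : ℕ) ≤ n}.Finite :=
      Set.Finite.preimage Subtype.val_injective.injOn (Set.finite_Iic n)
    obtain ⟨T, hT, hn⟩ := ((frequently_norm_realChar_add_one_lt
      (fun i : hfin.toFinset => Real.log (i : Nat.Primes))
      (fun e e' => eq_of_sum_mul_log_prime_eq
        (P := fun i : hfin.toFinset => ((i : Nat.Primes) : ℕ))
        (fun i => (i : Nat.Primes).2) fun i j h => Subtype.ext (Subtype.ext h))
      (show (0 : ℝ) < 1 / ((n : ℝ) + 1) by positivity)).and_eventually
        (eventually_ge_atTop (n : ℝ))).exists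
    exact ⟨T, hn, fun p hp => hT ⟨p, by simpa using hp⟩⟩
  choose T hn hT using h
  refine ⟨T, tendsto_atTop_mono hn tendsto_natCast_atTop_atTop, fun p => ?_⟩
  have h1 : Tendsto (fun n => realChar (Real.log p) (T n)) atTop (nhds (-1)) := by
    rw [tendsto_iff_norm_sub_tendsto_zero]
    refine squeeze_zero' (Eventually.of_forall fun _ => norm_nonneg _) ?_
      tendsto_one_div_add_atTop_nhds_zero_nat
    filter_upwards [eventually_ge_atTop (p : ℕ)] with n hpn
    rw [sub_neg_eq_add]
    exact (hT n p hpn).le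
  simpa [Function.comp_def, conj_realChar] using
    (Complex.continuous_conj.tendsto (-1 : ℂ)).comp h1

/-- The logarithm of the Euler product `∏ (1 - c p * p ^ (-(σ + it)))⁻¹`. -/
noncomputable def logEulerProduct (σ : ℝ) (c : Nat.Primes → ℂ) (t : ℝ) : ℂ :=
  ∑' q : Nat.Primes,
    -Complex.log (1 - c q * ((((q : ℝ) ^ (-σ) : ℝ) : ℂ) * realChar (-Real.log q) t))

lemma natCast_cpow_neg_eq_realChar (σ t : ℝ) {n : ℕ} (hn : 0 < n) :
    (n : ℂ) ^ (-(σ + t * I) : ℂ) = (((n : ℝ) ^ (-σ) : ℝ) : ℂ) * realChar (-Real.log n) t := by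
  have hn' : (n : ℂ) ≠ 0 := by exact_mod_cast hn.ne'
  rw [neg_add, Complex.cpow_add _ _ hn', ofReal_cpow (by positivity)]
  congr 1
  · push_cast; rfl
  · rw [Complex.cpow_def_of_ne_zero hn', realChar, ← natCast_log]
    congr 1; push_cast; ring

lemma primes_rpow_neg_le_half {σ : ℝ} (hσ : 1 < σ) (q : Nat.Primes) :
    (q : ℝ) ^ (-σ) ≤ 1 / 2 := by
  have hq : (2 : ℝ) ≤ (q : ℕ) := by exact_mod_cast q.2.two_le
  calc (q : ℝ) ^ (-σ) ≤ (q : ℝ) ^ (-1 : ℝ) :=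
        Real.rpow_le_rpow_of_exponent_le (by linarith) (by linarith)
    _ = ((q : ℕ) : ℝ)⁻¹ := Real.rpow_neg_one _
    _ ≤ 1 / 2 := by rw [one_div]; gcongr

lemma summable_primes_rpow_neg {σ : ℝ} (hσ : 1 < σ) :
    Summable fun q : Nat.Primes => (q : ℝ) ^ (-σ) :=
  Nat.Primes.summable_rpow.2 (by linarith)

lemma norm_mul_rpow_mul_realChar_le (σ : ℝ) {c : ℂ} (hc : ‖c‖ ≤ 1) (q : Nat.Primes) (ω t : ℝ) :
    ‖c * ((((q : ℝ) ^ (-σ) : ℝ) : ℂ) * realChar ω t)‖ ≤ (q : ℝ) ^ (-σ) := by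
  have h : (0 : ℝ) ≤ (q : ℝ) ^ (-σ) := by positivity
  rw [norm_mul, norm_mul, norm_realChar, mul_one, norm_real, norm_of_nonneg h]
  exact mul_le_of_le_one_left h hc

lemma norm_neg_log_one_sub_le {z : ℂ} {r : ℝ} (hz : ‖z‖ ≤ r) (hr : r ≤ 1 / 2) :
    ‖-Complex.log (1 - z)‖ ≤ 3 / 2 * r := by
  rw [norm_neg, sub_eq_add_neg]
  have := norm_log_one_add_half_le_self (z := -z) (by rw [norm_neg]; exact hz.trans hr)
  rw [norm_neg] at this
  linarith

lemma norm_logEulerProduct_term_le {σ : ℝ} (hσ : 1 < σ) {c : Nat.Primes → ℂ}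
    (hc : ∀ q, ‖c q‖ ≤ 1) (q : Nat.Primes) (t : ℝ) :
    ‖-Complex.log (1 - c q * ((((q : ℝ) ^ (-σ) : ℝ) : ℂ) * realChar (-Real.log q) t))‖ ≤
      3 / 2 * (q : ℝ) ^ (-σ) :=
  norm_neg_log_one_sub_le (norm_mul_rpow_mul_realChar_le σ (hc q) q _ t)
    (primes_rpow_neg_le_half hσ q)

lemma hasSum_logEulerProduct {σ : ℝ} (hσ : 1 < σ) {c : Nat.Primes → ℂ}
    (hc : ∀ q, ‖c q‖ ≤ 1) (t : ℝ) : HasSum (fun q : Nat.Primes =>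
    -Complex.log (1 - c q * ((((q : ℝ) ^ (-σ) : ℝ) : ℂ) * realChar (-Real.log q) t)))
    (logEulerProduct σ c t) :=
  (Summable.of_norm_bounded ((summable_primes_rpow_neg hσ).mul_left (3 / 2))
    fun q => norm_logEulerProduct_term_le hσ hc q t).hasSum

lemma majorized_logEulerProduct {σ : ℝ} (hσ : 1 < σ) {c : Nat.Primes → ℂ}
    (hc : ∀ q, ‖c q‖ ≤ 1) (ν : Measure ℝ) [IsFiniteMeasure ν] :
    Majorized ν (logEulerProduct σ c) (logEulerProduct σ fun _ => 1) := by
  refine Majorized.hasSum (fun q : Nat.Primes => ?_)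
    ((summable_primes_rpow_neg hσ).mul_left (3 / 2))
    (fun q t => norm_logEulerProduct_term_le hσ hc q t)
    (fun q t => norm_logEulerProduct_term_le (c := fun _ => 1) hσ (by simp) q t)
    (hasSum_logEulerProduct hσ hc) (hasSum_logEulerProduct hσ (by simp))
  simp only [one_mul]
  exact Majorized.neg_log_one_sub (by positivity)
    ((primes_rpow_neg_le_half hσ q).trans_lt (by norm_num)) (hc q) _

lemma norm_logEulerProduct_le {σ : ℝ} (hσ : 1 < σ) {c : Nat.Primes → ℂ}
    (hc : ∀ q, ‖c q‖ ≤ 1) (t : ℝ) :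
    ‖logEulerProduct σ c t‖ ≤ ∑' q : Nat.Primes, 3 / 2 * (q : ℝ) ^ (-σ) :=
  tsum_of_norm_bounded ((summable_primes_rpow_neg hσ).mul_left (3 / 2)).hasSum
    fun q => norm_logEulerProduct_term_le hσ hc q t

lemma tendsto_logEulerProduct {σ : ℝ} (hσ : 1 < σ) {ι : Type*} {l : Filter ι}
    {c : ι → Nat.Primes → ℂ} (hc : ∀ i q, ‖c i q‖ ≤ 1)
    (hlim : ∀ q, Tendsto (fun i => c i q) l (nhds 1)) (t : ℝ) :
    Tendsto (fun i => logEulerProduct σ (c i) t) l (nhds (logEulerProduct σ (fun _ => 1) t)) := by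
  refine tendsto_tsum_of_dominated_convergence ((summable_primes_rpow_neg hσ).mul_left (3 / 2))
    (fun q => ?_) (Eventually.of_forall fun i q => norm_logEulerProduct_term_le hσ (hc i) q t)
  have hlt : ‖-((1 : ℂ) * ((((q : ℝ) ^ (-σ) : ℝ) : ℂ) * realChar (-Real.log q) t))‖ < 1 := by
    rw [norm_neg]
    exact (norm_mul_rpow_mul_realChar_le σ (by simp) q _ t).trans_lt
      ((primes_rpow_neg_le_half hσ q).trans_lt (by norm_num))
  refine (Tendsto.clog (((hlim q).mul_const _).const_sub 1) ?_).neg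
  rw [sub_eq_add_neg]
  exact mem_slitPlane_of_norm_lt_one hlt

lemma log_one_sub_sq {z : ℂ} (hz : ‖z‖ < 1) :
    Complex.log (1 - z ^ 2) = Complex.log (1 - z) + Complex.log (1 + z) := by
  have hre := abs_lt.1 ((abs_re_le_norm z).trans_lt hz)
  have h1 : 0 < (1 - z).re := by rw [sub_re, one_re]; linarith
  have h2 : 0 < (1 + z).re := by rw [add_re, one_re]; linarith
  have a1 := abs_lt.1 (abs_arg_lt_pi_div_two_iff.2 (Or.inl h1))
  have a2 := abs_lt.1 (abs_arg_lt_pi_div_two_iff.2 (Or.inl h2))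
  rw [show 1 - z ^ 2 = (1 - z) * (1 + z) by ring]
  refine Complex.log_mul (fun h => ?_) (fun h => ?_) ⟨by linarith, by linarith⟩
  · simp [h] at h1
  · simp [h] at h2

lemma riemannZeta_eq_exp_logEulerProduct {σ : ℝ} (hσ : 1 < σ) (t : ℝ) :
    riemannZeta (σ + t * I) = cexp (logEulerProduct σ (fun _ => 1) t) := by
  rw [← riemannZeta_eulerProduct_exp_log (s := σ + t * I) (by simpa using hσ), logEulerProduct]
  simp only [one_mul]
  congr 1
  exact tsum_congr fun q => by rw [natCast_cpow_neg_eq_realChar σ t q.2.pos]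

lemma riemannZeta_two_mul_div_eq_exp_logEulerProduct {σ : ℝ} (hσ : 1 < σ) (T t : ℝ) :
    riemannZeta (2 * σ + 2 * (T + t) * I) / riemannZeta (σ + (T + t) * I) =
      cexp (logEulerProduct σ (fun q => -realChar (-Real.log q) T) t) := by
  have hden := riemannZeta_eq_exp_logEulerProduct hσ (T + t)
  have hnum : riemannZeta (2 * σ + 2 * (T + t) * I) =
      cexp (logEulerProduct σ (fun _ => 1) (T + t) +
        logEulerProduct σ (fun q => -realChar (-Real.log q) T) t) := by
    rw [← riemannZeta_eulerProduct_exp_log (s := 2 * σ + 2 * (T + t) * I) (by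
      simp; linarith)]
    congr 1
    refine HasSum.tsum_eq ?_
    convert (hasSum_logEulerProduct hσ (c := fun _ => 1) (by simp) (T + t)).add
      (hasSum_logEulerProduct hσ (c := fun q => -realChar (-Real.log q) T)
        (fun q => by rw [norm_neg, norm_realChar]) t) using 2 with q
    have hz := norm_mul_rpow_mul_realChar_le σ (c := 1) (by simp) q (-Real.log q) (T + t)
    rw [one_mul] at hz
    have hpow : (q : ℂ) ^ (-(2 * σ + 2 * (T + t) * I) : ℂ) =
        ((((q : ℝ) ^ (-σ) : ℝ) : ℂ) * realChar (-Real.log q) (T + t)) ^ 2 := by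
      rw [← natCast_cpow_neg_eq_realChar σ (T + t) q.2.pos, ← Complex.cpow_nat_mul]
      congr 1; push_cast; ring
    rw [hpow, log_one_sub_sq (hz.trans_lt
      ((primes_rpow_neg_le_half hσ q).trans_lt (by norm_num))), neg_add, one_mul]
    congr 3
    rw [realChar_add_right]; ring
  push_cast at hden
  rw [hnum, hden, ← Complex.exp_sub]
  congr 1; ring

lemma norm_exp_rpow (z : ℂ) (p : ℝ) : ‖cexp z‖ ^ p = rexp (p * z.re) := by
  rw [Complex.norm_exp, ← Real.exp_mul, mul_comm]

theorem stmt_6 (σ : ℝ) (hσ : 1 < σ) (p : ℝ) (hp : 0 ≤ p) (δ : ℝ) (hδ : 0 < δ) :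
    (⨆ T : ℝ, ((∫ t in (-δ)..δ,
        ‖riemannZeta (2 * σ + 2 * (T + t) * Complex.I) /
          riemannZeta (σ + (T + t) * Complex.I)‖ ^ p * (δ - |t|) : ℝ) : EReal)) =
      ((∫ t in (-δ)..δ, ‖riemannZeta (σ + t * Complex.I)‖ ^ p * (δ - |t|) : ℝ) : EReal) ∧
    Filter.limsup (fun T : ℝ => ((∫ t in (-δ)..δ,
        ‖riemannZeta (2 * σ + 2 * (T + t) * Complex.I) /
          riemannZeta (σ + (T + t) * Complex.I)‖ ^ p * (δ - |t|) : ℝ) : EReal)) Filter.atTop =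
      ((∫ t in (-δ)..δ, ‖riemannZeta (σ + t * Complex.I)‖ ^ p * (δ - |t|) : ℝ) : EReal) := by
  set c : ℝ → Nat.Primes → ℂ := fun T q => -realChar (-Real.log q) T with hc_def
  have hc (T : ℝ) (q : Nat.Primes) : ‖c T q‖ ≤ 1 := by rw [hc_def, norm_neg, norm_realChar]
  have hI (T : ℝ) : ∫ t in (-δ)..δ, ‖riemannZeta (2 * σ + 2 * (T + t) * Complex.I) /
        riemannZeta (σ + (T + t) * Complex.I)‖ ^ p * (δ - |t|) =
      ∫ t, rexp (p * (logEulerProduct σ (c T) t).re) ∂(triangleMeasure δ) := by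
    simp only [integral_triangleMeasure hδ, riemannZeta_two_mul_div_eq_exp_logEulerProduct hσ,
      norm_exp_rpow, smul_eq_mul, mul_comm (δ - |_|), hc_def]
  have hJ : ∫ t in (-δ)..δ, ‖riemannZeta (σ + t * Complex.I)‖ ^ p * (δ - |t|) =
      ∫ t, rexp (p * (logEulerProduct σ (fun _ => 1) t).re) ∂(triangleMeasure δ) := by
    simp only [integral_triangleMeasure hδ, riemannZeta_eq_exp_logEulerProduct hσ,
      norm_exp_rpow, smul_eq_mul, mul_comm (δ - |_|)]
  simp only [hI, hJ]
  have hmaj (T : ℝ) := (majorized_logEulerProduct hσ (hc T) (triangleMeasure δ)).exp_re hp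
  have hupper : (⨆ T : ℝ, ((∫ t, rexp (p * (logEulerProduct σ (c T) t).re)
      ∂(triangleMeasure δ) : ℝ) : EReal)) ≤
      ((∫ t, rexp (p * (logEulerProduct σ (fun _ => 1) t).re) ∂(triangleMeasure δ) : ℝ) :
        EReal) :=
    iSup_le fun T => EReal.coe_le_coe_iff.2
      ((hmaj T).integral_le (norm_integral_realChar_triangleMeasure_le hδ))
  obtain ⟨T, hT, hTlim⟩ := exists_seq_realChar_log_prime_tendsto
  have hlim : Tendsto (fun n => ∫ t, rexp (p * (logEulerProduct σ (c (T n)) t).re)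
      ∂(triangleMeasure δ)) atTop
      (nhds (∫ t, rexp (p * (logEulerProduct σ (fun _ => 1) t).re) ∂(triangleMeasure δ))) := by
    refine tendsto_integral_of_dominated_convergence
      (fun _ => rexp (p * ∑' q : Nat.Primes, 3 / 2 * (q : ℝ) ^ (-σ))) (fun n => ?_)
      (integrable_const _) (fun n => Eventually.of_forall fun t => ?_)
      (Eventually.of_forall fun t => ?_)
    · have hmeas := (majorized_logEulerProduct hσ (hc (T n)) (triangleMeasure δ)).left.1
      exact ((measurable_re.comp hmeas).const_mul p).exp.aestronglyMeasurable
    · rw [norm_of_nonneg (Real.exp_pos _).le]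
      gcongr
      exact (re_le_norm _).trans (norm_logEulerProduct_le hσ (hc (T n)) t)
    · have h1 := tendsto_logEulerProduct hσ (c := fun n => c (T n)) (fun n => hc (T n))
        (fun q => by simpa using (hTlim q).neg) t
      exact (Real.continuous_exp.tendsto _).comp
        (((continuous_re.tendsto _).comp h1).const_mul p)
  have hlower : ((∫ t, rexp (p * (logEulerProduct σ (fun _ => 1) t).re)
      ∂(triangleMeasure δ) : ℝ) : EReal) ≤
      Filter.limsup (fun T : ℝ => ((∫ t, rexp (p * (logEulerProduct σ (c T) t).re)
        ∂(triangleMeasure δ) : ℝ) : EReal)) atTop := by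
    rw [← ((continuous_coe_real_ereal.tendsto _).comp hlim).limsup_eq]
    exact limsup_le_limsup_of_le (f := map T atTop)
      (u := fun T : ℝ => ((∫ t, rexp (p * (logEulerProduct σ (c T) t).re)
        ∂(triangleMeasure δ) : ℝ) : EReal)) hT
  exact ⟨le_antisymm hupper (hlower.trans limsup_le_iSup),
    le_antisymm (limsup_le_iSup.trans hupper) hlower⟩
end

section
/- Let −1 < p < 1 and δ > 0. Then 0.3 · δ^{1−|p|}/(1−|p|) ≤ limsup_{T → ∞} ∫_T^{T+δ} |ζ(1+it)|^p dt ≤ 12 · δ^{1−|p|}/(1−|p|) + 6δ(1 + log(1+δ)). -/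
open Complex Real Filter MeasureTheory intervalIntegral

/-- The characteristic function of the centred Cauchy distribution, on nonnegative frequencies. -/
lemma integral_cos_mul_cauchyPDFReal {ε : NNReal} (hε : 0 < ε) {l : ℝ} (hl : 0 ≤ l) :
    ∫ u, Real.cos (l * u) * ProbabilityTheory.cauchyPDFReal 0 ε u = Real.exp (-(ε * l)) := by
  set a : ℝ := 2 * π * ε with ha
  have ha0 : 0 < a := by positivity
  let f : ℝ → ℂ := fun x => Complex.exp (-(a * |x| : ℝ))
  have hfc : Continuous f := by fun_prop
  have hf1 : IntegrableOn f (Set.Ioi 0) := by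
    refine (integrableOn_exp_mul_complex_Ioi (a := -a) (by simpa) 0).congr_fun ?_ measurableSet_Ioi
    intro x hx
    simp [f, abs_of_pos (Set.mem_Ioi.1 hx)]
  have hf2 : IntegrableOn f (Set.Iic 0) := by
    refine (integrableOn_exp_mul_complex_Iic (a := a) (by simpa) 0).congr_fun ?_ measurableSet_Iic
    intro x hx
    simp [f, abs_of_nonpos (Set.mem_Iic.1 hx)]
  have hfi : Integrable f := by
    rw [← integrableOn_univ, ← Set.Iic_union_Ioi (a := (0 : ℝ))]
    exact hf2.union hf1
  have hF : FourierTransform.fourier f =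
      fun w => ((ProbabilityTheory.cauchyPDFReal 0 ε w : ℝ) : ℂ) := by
    ext w
    rw [Real.fourier_real_eq_integral_exp_smul]
    have h1 : (fun x : ℝ => Complex.exp (↑(-2 * π * x * w) * I) • f x) =
        fun x => Complex.exp (↑(-2 * π * x * w) * I - (a * |x| : ℝ)) := by
      ext x
      simp [f, sub_eq_add_neg, Complex.exp_add]
    have hfint : Integrable fun x : ℝ => Complex.exp (↑(-2 * π * x * w) * I) • f x := by
      refine hfi.bdd_mul (c := 1) (by fun_prop) ?_
      filter_upwards with x
      rw [Complex.norm_exp_ofReal_mul_I]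
    rw [← intervalIntegral.integral_Iic_add_Ioi (b := 0) hfint.integrableOn hfint.integrableOn]
    have e1 : ∫ x in Set.Iic (0 : ℝ), Complex.exp (↑(-2 * π * x * w) * I) • f x =
        ∫ x in Set.Iic (0 : ℝ), Complex.exp ((a - 2 * π * w * I) * x) := by
      refine setIntegral_congr_fun measurableSet_Iic fun x hx => ?_
      simp only [f, abs_of_nonpos (Set.mem_Iic.1 hx), smul_eq_mul, ← Complex.exp_add]
      congr 1; push_cast; ring
    have e2 : ∫ x in Set.Ioi (0 : ℝ), Complex.exp (↑(-2 * π * x * w) * I) • f x =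
        ∫ x in Set.Ioi (0 : ℝ), Complex.exp ((-a - 2 * π * w * I) * x) := by
      refine setIntegral_congr_fun measurableSet_Ioi fun x hx => ?_
      simp only [f, abs_of_pos (Set.mem_Ioi.1 hx), smul_eq_mul, ← Complex.exp_add]
      congr 1; push_cast; ring
    have r1 : ((a : ℂ) - 2 * π * w * I).re = a := by simp
    have r2 : (-(a : ℂ) - 2 * π * w * I).re = -a := by simp
    rw [e1, e2, integral_exp_mul_complex_Iic (by rw [r1]; exact ha0),
      integral_exp_mul_complex_Ioi (by rw [r2]; linarith),
      ProbabilityTheory.cauchyPDFReal_def]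
    have n1 : (a : ℂ) - 2 * π * w * I ≠ 0 := fun h => by
      have := congrArg Complex.re h; rw [r1] at this; simp at this; linarith
    have n2 : -(a : ℂ) - 2 * π * w * I ≠ 0 := fun h => by
      have := congrArg Complex.re h; rw [r2] at this; simp at this; linarith
    have n3 : ((w : ℂ) ^ 2 + (ε : ℝ) ^ 2) ≠ 0 := by
      have : (w ^ 2 + (ε : ℝ) ^ 2) ≠ 0 := by positivity
      exact_mod_cast this
    have n4 : (π : ℂ) ≠ 0 := by exact_mod_cast Real.pi_ne_zero
    simp only [ofReal_zero, mul_zero, Complex.exp_zero, sub_zero]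
    have key : ((a : ℂ) - 2 * π * w * I) * (-(a : ℂ) - 2 * π * w * I) =
        -(4 * π ^ 2 * ((w : ℂ) ^ 2 + (ε : ℝ) ^ 2)) := by
      rw [ha]; push_cast
      linear_combination (4 * (π : ℂ) ^ 2 * w ^ 2) * I_sq
    have : (1 : ℂ) / (a - 2 * π * w * I) + -1 / (-a - 2 * π * w * I) =
        (-2 * a) / ((a - 2 * π * w * I) * (-(a : ℂ) - 2 * π * w * I)) := by
      field_simp
      ring
    rw [this, key, ha]
    push_cast at n3 ⊢
    field_simp
    ring
  have hFi : Integrable (FourierTransform.fourier f) := by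
    rw [hF]
    exact (ProbabilityTheory.integrable_cauchyPDFReal 0 (γ := ε)).ofReal
  have inv := congrFun (hfc.fourierInv_fourier_eq hfi hFi) (l / (2 * π))
  rw [hF, Real.fourierInv_eq'] at inv
  have inv' := congrArg Complex.re inv
  have hfint : Integrable fun v : ℝ => Complex.exp (↑(2 * π * inner ℝ v (l / (2 * π))) * I) •
      ((ProbabilityTheory.cauchyPDFReal 0 ε v : ℝ) : ℂ) := by
    rw [hF] at hFi
    refine hFi.bdd_mul (c := 1) (by fun_prop) ?_
    filter_upwards with x
    rw [Complex.norm_exp_ofReal_mul_I]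
  rw [← Complex.reCLM_apply, ← ContinuousLinearMap.integral_comp_comm _ hfint] at inv'
  convert inv' using 1
  · refine integral_congr_ae (Eventually.of_forall fun v => ?_)
    simp only [Complex.reCLM_apply, smul_eq_mul, Complex.re_mul_ofReal, Complex.exp_ofReal_mul_I_re]
    congr 2
    simp
    field_simp
  · simp only [f]
    rw [← Complex.ofReal_neg, Complex.exp_ofReal_re]
    congr 2
    rw [abs_of_nonneg (by positivity), ha]
    field_simp

lemma integral_cos_mul_add_cauchyMeasure {ε : NNReal} (hε : 0 < ε) {l : ℝ} (hl : 0 ≤ l) (t : ℝ) :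
    ∫ u, Real.cos (l * (t + u)) ∂(ProbabilityTheory.cauchyMeasure 0 ε) =
      Real.exp (-(ε * l)) * Real.cos (l * t) := by
  have hi := ProbabilityTheory.integrable_cauchyPDFReal 0 (γ := ε)
  have hc : Integrable fun u => Real.cos (l * u) * ProbabilityTheory.cauchyPDFReal 0 ε u :=
    hi.bdd_mul (c := 1) (by fun_prop) (Eventually.of_forall fun u => Real.abs_cos_le_one _)
  have hs : Integrable fun u => Real.sin (l * u) * ProbabilityTheory.cauchyPDFReal 0 ε u :=
    hi.bdd_mul (c := 1) (by fun_prop) (Eventually.of_forall fun u => Real.abs_sin_le_one _)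
  have h0 : ∫ u, Real.sin (l * u) * ProbabilityTheory.cauchyPDFReal 0 ε u = 0 := by
    have h := integral_neg_eq_self
      (fun u => Real.sin (l * u) * ProbabilityTheory.cauchyPDFReal 0 ε u) volume
    simp only [ProbabilityTheory.cauchyPDFReal_def, mul_neg, Real.sin_neg, sub_zero, even_two,
      Even.neg_pow, neg_mul, MeasureTheory.integral_neg] at h ⊢
    linarith
  rw [ProbabilityTheory.cauchyMeasure_of_scale_ne_zero 0 hε.ne']
  unfold ProbabilityTheory.cauchyPDF
  rw [integral_withDensity_eq_integral_toReal_smul (by fun_prop) (by simp)]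
  have : ∀ u, (ENNReal.ofReal (ProbabilityTheory.cauchyPDFReal 0 ε u)).toReal •
      Real.cos (l * (t + u)) =
      Real.cos (l * t) * (Real.cos (l * u) * ProbabilityTheory.cauchyPDFReal 0 ε u) -
      Real.sin (l * t) * (Real.sin (l * u) * ProbabilityTheory.cauchyPDFReal 0 ε u) := by
    intro u
    rw [ENNReal.toReal_ofReal (ProbabilityTheory.cauchyPDF_pos 0 hε.ne' u).le, mul_add,
      Real.cos_add, smul_eq_mul]
    ring
  simp_rw [this]
  rw [integral_sub (hc.const_mul _) (hs.const_mul _), MeasureTheory.integral_const_mul,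
    MeasureTheory.integral_const_mul,
    integral_cos_mul_cauchyPDFReal hε hl, h0]
  ring

/-- The coefficient of `cos (t (k + 1) log q)` in `log |ζ(σ + it)|`. -/
noncomputable def logZetaCoeff (σ : ℝ) (i : Nat.Primes × ℕ) : ℝ :=
  (i.1 : ℝ) ^ (-(σ * (i.2 + 1))) / (i.2 + 1)

/-- The frequencies `(k + 1) log q` of `log |ζ(σ + it)|`. -/
noncomputable def logZetaFreq (i : Nat.Primes × ℕ) : ℝ := (i.2 + 1) * Real.log i.1

/-- The function `log |ζ(σ + it)|` for `1 < σ`, as a cosine series. -/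
noncomputable def logZeta (σ t : ℝ) : ℝ :=
  ∑' i, logZetaCoeff σ i * Real.cos (logZetaFreq i * t)

lemma logZetaCoeff_nonneg (σ : ℝ) (i : Nat.Primes × ℕ) : 0 ≤ logZetaCoeff σ i := by
  unfold logZetaCoeff; positivity

lemma logZetaFreq_nonneg (i : Nat.Primes × ℕ) : 0 ≤ logZetaFreq i :=
  mul_nonneg (by positivity) (Real.log_natCast_nonneg _)

lemma summable_prime_pow {σ : ℝ} (hσ : 1 < σ) :
    Summable fun i : Nat.Primes × ℕ => (i.1 : ℝ) ^ (-(σ * (i.2 + 1))) := by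
  have h1 : Summable fun p : Nat.Primes => (p : ℝ) ^ (-σ) :=
    Nat.Primes.summable_rpow.2 (by linarith)
  refine Summable.of_nonneg_of_le (fun i => by positivity) (fun i => ?_)
    (h1.mul_of_nonneg summable_geometric_two (fun p => by positivity) fun k => by positivity)
  have hp : (2 : ℝ) ≤ i.1 := by exact_mod_cast i.1.2.two_le
  have hp0 : (0 : ℝ) < i.1 := by linarith
  rw [mul_add, mul_one, neg_add, add_comm, Real.rpow_add hp0]
  refine mul_le_mul_of_nonneg_left ?_ (by positivity)
  rw [← neg_mul, Real.rpow_mul hp0.le, Real.rpow_natCast]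
  refine pow_le_pow_left₀ (by positivity) ?_ _
  calc (i.1 : ℝ) ^ (-σ) ≤ (i.1 : ℝ) ^ (-1 : ℝ) :=
        Real.rpow_le_rpow_of_exponent_le (by linarith) (by linarith)
    _ = 1 / i.1 := by rw [Real.rpow_neg_one, one_div]
    _ ≤ 1 / 2 := one_div_le_one_div_of_le two_pos hp

lemma summable_logZetaCoeff {σ : ℝ} (hσ : 1 < σ) : Summable (logZetaCoeff σ) := by
  refine (summable_prime_pow hσ).of_nonneg_of_le (logZetaCoeff_nonneg σ) fun i => ?_
  exact div_le_self (by positivity) (by linarith [Nat.cast_nonneg (α := ℝ) i.2])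

lemma logZetaCoeff_add (σ ε : ℝ) (i : Nat.Primes × ℕ) :
    logZetaCoeff (σ + ε) i = logZetaCoeff σ i * Real.exp (-(ε * logZetaFreq i)) := by
  have hp0 : (0 : ℝ) < i.1 := by exact_mod_cast i.1.2.pos
  unfold logZetaCoeff logZetaFreq
  rw [Real.rpow_def_of_pos hp0, Real.rpow_def_of_pos hp0, div_mul_eq_mul_div, ← Real.exp_add]
  congr 2
  ring

lemma hasSum_logZeta {σ : ℝ} (hσ : 1 < σ) (t : ℝ) :
    HasSum (fun i => logZetaCoeff σ i * Real.cos (logZetaFreq i * t)) (logZeta σ t) := by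
  refine (Summable.of_norm_bounded (summable_logZetaCoeff hσ) fun i => ?_).hasSum
  rw [norm_mul, Real.norm_of_nonneg (logZetaCoeff_nonneg σ i)]
  exact mul_le_of_le_one_right (logZetaCoeff_nonneg σ i) (Real.abs_cos_le_one _)

lemma norm_riemannZeta_eq_exp {σ : ℝ} (hσ : 1 < σ) (t : ℝ) :
    ‖riemannZeta (σ + t * I)‖ = Real.exp (logZeta σ t) := by
  have hs : 1 < ((σ : ℂ) + t * I).re := by simpa
  rw [← riemannZeta_eulerProduct_exp_log hs, Complex.norm_exp]
  congr 1
  set s : ℂ := σ + t * I with hsdef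
  let g : Nat.Primes × ℕ → ℂ := fun i => ((i.1 : ℂ) ^ (-s)) ^ (i.2 + 1) / (i.2 + 1)
  have hpow : ∀ i : Nat.Primes × ℕ, ((i.1 : ℂ) ^ (-s)) ^ (i.2 + 1) =
      ((i.1 : ℝ) ^ (-(σ * (i.2 + 1))) : ℝ) * Complex.exp ((-(logZetaFreq i * t) : ℝ) * I) := by
    intro i
    have hp0 : (0 : ℝ) < i.1 := by exact_mod_cast i.1.2.pos
    have hpc : ((i.1 : ℕ) : ℂ) ≠ 0 := by exact_mod_cast hp0.ne'
    rw [Complex.cpow_def_of_ne_zero hpc, ← Complex.exp_nat_mul, Real.rpow_def_of_pos hp0,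
      Complex.ofReal_exp, ← Complex.exp_add]
    congr 1
    rw [← Complex.natCast_log]
    simp only [hsdef, logZetaFreq]
    push_cast
    ring
  have hnorm : ∀ i, ‖g i‖ = logZetaCoeff σ i := by
    intro i
    simp only [g, hpow, logZetaCoeff]
    rw [norm_div, norm_mul, Complex.norm_exp_ofReal_mul_I, mul_one, Complex.norm_real,
      Real.norm_of_nonneg (by positivity)]
    congr 1
    rw [← Nat.cast_add_one, Complex.norm_natCast]
    push_cast; rfl
  have hg : Summable g := Summable.of_norm (by simpa only [hnorm] using summable_logZetaCoeff hσ)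
  have hre : ∀ i, (g i).re = logZetaCoeff σ i * Real.cos (logZetaFreq i * t) := by
    intro i
    simp only [g, hpow, logZetaCoeff]
    have : ((i.2 : ℂ) + 1) = ((i.2 + 1 : ℝ) : ℂ) := by push_cast; rfl
    rw [this, Complex.div_ofReal_re, Complex.re_ofReal_mul, Complex.exp_ofReal_mul_I_re,
      Real.cos_neg]
    ring
  have hlog : ∀ p : Nat.Primes, ∑' k, g (p, k) = -Complex.log (1 - (p : ℂ) ^ (-s)) := by
    intro p
    have hp : ‖(p : ℂ) ^ (-s)‖ < 1 := by
      rw [norm_natCast_cpow_of_pos p.2.pos]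
      refine Real.rpow_lt_one_of_one_lt_of_neg (by exact_mod_cast p.2.one_lt) ?_
      simp only [hsdef, Complex.neg_re]; linarith
    exact (hasSum_taylorSeries_neg_log' hp).tsum_eq
  simp_rw [← hlog]
  rw [← hg.tsum_prod, Complex.re_tsum hg]
  exact tsum_congr hre

lemma abs_logZeta_le {σ : ℝ} (hσ : 1 < σ) (t : ℝ) : |logZeta σ t| ≤ logZeta σ 0 := by
  have h0 := hasSum_logZeta hσ 0
  simp only [mul_zero, Real.cos_zero, mul_one] at h0
  refine HasSum.norm_le_of_bounded (hasSum_logZeta hσ t) h0 fun i => ?_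
  rw [norm_mul, Real.norm_of_nonneg (logZetaCoeff_nonneg σ i)]
  exact mul_le_of_le_one_right (logZetaCoeff_nonneg σ i) (Real.abs_cos_le_one _)

lemma continuous_logZeta {σ : ℝ} (hσ : 1 < σ) : Continuous (logZeta σ) := by
  refine continuous_tsum (fun i => by fun_prop) (summable_logZetaCoeff hσ) fun i t => ?_
  rw [norm_mul, Real.norm_of_nonneg (logZetaCoeff_nonneg σ i)]
  exact mul_le_of_le_one_right (logZetaCoeff_nonneg σ i) (Real.abs_cos_le_one _)

lemma norm_riemannZeta_rpow {σ : ℝ} (hσ : 1 < σ) (t p : ℝ) :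
    ‖riemannZeta (σ + t * I)‖ ^ p = Real.exp (p * logZeta σ t) := by
  rw [norm_riemannZeta_eq_exp hσ, ← Real.exp_mul, mul_comm]

lemma norm_cpow_neg_sub_step_le {s : ℂ} (hs : 1 < s.re) {n : ℝ} (hn : 0 < n) :
    ‖((n + 1 : ℝ) : ℂ) ^ (-s) + ((n + 1 : ℝ) : ℂ) ^ (1 - s) / (s - 1) -
      (n : ℂ) ^ (1 - s) / (s - 1)‖ ≤
      ‖s‖ / s.re * (n ^ (-s.re) - (n + 1) ^ (-s.re)) := by
  have hs0 : 0 < s.re := by linarith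
  have hsne : s ≠ 0 := fun h => by simp [h] at hs0
  have hs1 : s - 1 ≠ 0 := fun h => by
    have := congrArg Complex.re h
    simp at this; linarith
  have hs1' : 1 - s ≠ 0 := fun h => hs1 (by linear_combination -h)
  let f : ℝ → ℂ := fun x =>
    ((x : ℂ) - n) * (x : ℂ) ^ (-s) + (x : ℂ) ^ (1 - s) / (s - 1) - (n : ℂ) ^ (1 - s) / (s - 1)
  have hf : ∀ x : ℝ, 0 < x → HasDerivAt f (-s * ((x : ℂ) - n) * (x : ℂ) ^ (-s - 1)) x := by
    intro x hx
    have d1 := hasDerivAt_ofReal_cpow_const hx.ne' (neg_ne_zero.2 hsne)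
    have d2 : HasDerivAt (fun y : ℝ => (y : ℂ) ^ (1 - s) / (s - 1)) (-(x : ℂ) ^ (-s)) x := by
      refine ((hasDerivAt_ofReal_cpow_const hx.ne' hs1').div_const (s - 1)).congr_deriv ?_
      rw [sub_sub_cancel_left, ← neg_sub s 1, neg_mul, neg_div, mul_div_cancel_left₀ _ hs1]
    have d0 : HasDerivAt (fun y : ℝ => (y : ℂ) - n) 1 x := (hasDerivAt_id x).ofReal_comp.sub_const _
    refine (((d0.mul d1).add d2).sub_const _).congr_deriv ?_
    ring
  have h := image_norm_le_of_norm_deriv_right_le_deriv_boundary' (f := f) (a := n) (b := n + 1)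
    (f' := fun x => -s * ((x : ℂ) - n) * (x : ℂ) ^ (-s - 1))
    (B := fun x => ‖s‖ / s.re * (n ^ (-s.re) - x ^ (-s.re)))
    (B' := fun x => ‖s‖ * x ^ (-s.re - 1))
    (fun x hx => (hf x (hn.trans_le hx.1)).continuousAt.continuousWithinAt)
    (fun x hx => (hf x (hn.trans_le hx.1)).hasDerivWithinAt) (by simp [f])
    (fun x hx => by
      have hx0 : x ≠ 0 := (hn.trans_le hx.1).ne'
      exact (continuousAt_const.mul (continuousAt_const.sub
        (Real.continuousAt_rpow_const x _ (.inl hx0)))).continuousWithinAt)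
    (fun x hx => by
      have hx0 : x ≠ 0 := (hn.trans_le hx.1).ne'
      have := ((Real.hasDerivAt_rpow_const (p := -s.re) (.inl hx0)).const_sub
        (n ^ (-s.re))).const_mul (‖s‖ / s.re)
      refine (this.congr_deriv ?_).hasDerivWithinAt
      field_simp)
    (fun x hx => by
      have hx0 : 0 < x := hn.trans_le hx.1
      rw [norm_mul, norm_mul, norm_neg, Complex.norm_cpow_eq_rpow_re_of_pos hx0,
        ← Complex.ofReal_sub, Complex.norm_real, Real.norm_of_nonneg (sub_nonneg.2 hx.1)]
      simp only [Complex.sub_re, Complex.neg_re, Complex.one_re]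
      refine mul_le_mul_of_nonneg_right ?_ (by positivity)
      exact mul_le_of_le_one_right (norm_nonneg _) (by linarith [hx.2]))
    (Set.right_mem_Icc.2 (by linarith))
  simpa [f] using h

lemma norm_riemannZeta_sub_le {s : ℂ} (hs : 1 < s.re) {N : ℕ} (hN : 0 < N) :
    ‖riemannZeta s - ∑ n ∈ Finset.range N, 1 / ((n : ℂ) + 1) ^ s - (N : ℂ) ^ (1 - s) / (s - 1)‖ ≤
      ‖s‖ / s.re * (N : ℝ) ^ (-s.re) := by
  have hs0 : 0 < s.re := by linarith
  have hN' : (0 : ℝ) < N := by exact_mod_cast hN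
  let S : ℕ → ℂ := fun M => ∑ n ∈ Finset.range M, 1 / ((n : ℂ) + 1) ^ s
  let W : ℕ → ℂ := fun M => (M : ℂ) ^ (1 - s) / (s - 1)
  have hstep : ∀ M : ℕ, ‖S (N + M) - S N + W (N + M) - W N‖ ≤
      ‖s‖ / s.re * ((N : ℝ) ^ (-s.re) - ((N + M : ℕ) : ℝ) ^ (-s.re)) := by
    intro M
    induction M with
    | zero => simp
    | succ M ih =>
      have hM : (0 : ℝ) < ((N + M : ℕ) : ℝ) := by exact_mod_cast Nat.add_pos_left hN M
      have h := norm_cpow_neg_sub_step_le hs hM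
      have e : S (N + (M + 1)) - S N + W (N + (M + 1)) - W N =
          (S (N + M) - S N + W (N + M) - W N) +
          ((((N + M : ℕ) : ℝ) + 1 : ℝ) ^ (-s) + (((N + M : ℕ) : ℝ) + 1 : ℝ) ^ (1 - s) / (s - 1) -
            ((((N + M : ℕ) : ℝ) : ℂ)) ^ (1 - s) / (s - 1)) := by
        simp only [S, W, ← add_assoc, Finset.sum_range_succ]
        rw [Complex.cpow_neg]
        push_cast
        ring
      rw [e]
      refine (norm_add_le _ _).trans ((add_le_add ih h).trans_eq ?_)
      push_cast
      ring_nf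
  have hS : Tendsto (fun M => S (N + M)) atTop (nhds (riemannZeta s)) := by
    have hsum : Summable fun n : ℕ => 1 / ((n : ℂ) + 1) ^ s := by
      have := (summable_nat_add_iff 1).2 (Complex.summable_one_div_nat_cpow.2 hs)
      simpa using this
    have := hsum.hasSum.tendsto_sum_nat
    rw [← zeta_eq_tsum_one_div_nat_add_one_cpow hs] at this
    simpa only [add_comm N] using (tendsto_add_atTop_iff_nat N).2 this
  have hW : Tendsto (fun M => W (N + M)) atTop (nhds 0) := by
    have h0 : Tendsto W atTop (nhds 0) := by
      rw [tendsto_zero_iff_norm_tendsto_zero]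
      have h1 : Tendsto (fun M : ℕ => (M : ℝ) ^ (-(s.re - 1)) / ‖s - 1‖) atTop (nhds (0 / ‖s - 1‖)) :=
        ((tendsto_rpow_neg_atTop (by linarith)).comp tendsto_natCast_atTop_atTop).div_const _
      rw [zero_div] at h1
      refine h1.congr' ?_
      filter_upwards [eventually_gt_atTop 0] with M hM
      simp only [W, norm_div]
      rw [norm_natCast_cpow_of_pos hM]
      simp
    simpa only [add_comm N] using (tendsto_add_atTop_iff_nat N).2 h0
  have hlim := (((hS.sub_const (S N)).add hW).sub_const (W N)).norm
  rw [add_zero] at hlim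
  refine le_of_tendsto hlim (Eventually.of_forall fun M => (hstep M).trans ?_)
  refine mul_le_mul_of_nonneg_left ?_ (by positivity)
  have : (0 : ℝ) ≤ ((N + M : ℕ) : ℝ) ^ (-s.re) := by positivity
  linarith

lemma norm_add_mul_I_div_le {σ : ℝ} (hσ : 1 < σ) (t : ℝ) : ‖(σ : ℂ) + t * I‖ / σ ≤ 1 + |t| := by
  rw [div_le_iff₀ (by linarith)]
  have h1 : ‖(σ : ℂ) + t * I‖ ≤ σ + |t| := by
    refine (norm_add_le _ _).trans_eq ?_
    simp [abs_of_pos (by linarith : 0 < σ)]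
  nlinarith [abs_nonneg t]

lemma norm_riemannZeta_le {σ : ℝ} (hσ : 1 < σ) {δ t : ℝ} (ht0 : t ≠ 0) (ht : |t| ≤ δ) :
    ‖riemannZeta (σ + t * I)‖ ≤ 1 / |t| + (3 + Real.log (1 + δ)) := by
  have hδ : 0 < δ := (abs_pos.2 ht0).trans_le ht
  set s : ℂ := σ + t * I with hsdef
  have hre : s.re = σ := by simp [hsdef]
  have hs : 1 < s.re := by rwa [hre]
  set N : ℕ := ⌊1 + δ⌋₊ with hNdef
  have hN1 : 1 ≤ N := Nat.le_floor (by push_cast; linarith)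
  have hN1' : (1 : ℝ) ≤ N := by exact_mod_cast hN1
  have hNle : (N : ℝ) ≤ 1 + δ := Nat.floor_le (by linarith)
  have hNgt : 1 + δ < N + 1 := Nat.lt_floor_add_one _
  have hN0 : (0 : ℝ) < N := by linarith
  have h := norm_riemannZeta_sub_le hs hN1
  rw [hre] at h
  have b1 : ‖∑ n ∈ Finset.range N, 1 / ((n : ℂ) + 1) ^ s‖ ≤ 1 + Real.log (1 + δ) := by
    calc ‖∑ n ∈ Finset.range N, 1 / ((n : ℂ) + 1) ^ s‖
        ≤ ∑ n ∈ Finset.range N, ((n : ℝ) + 1)⁻¹ := by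
          refine norm_sum_le_of_le _ fun n _ => ?_
          rw [norm_div, norm_one, ← Nat.cast_add_one, norm_natCast_cpow_of_pos n.succ_pos, hre,
            one_div]
          refine inv_anti₀ (by positivity) ?_
          push_cast
          exact Real.self_le_rpow_of_one_le (by linarith [Nat.cast_nonneg (α := ℝ) n]) hσ.le
      _ = ((harmonic N : ℚ) : ℝ) := by simp [harmonic]
      _ ≤ 1 + Real.log N := harmonic_le_one_add_log N
      _ ≤ 1 + Real.log (1 + δ) := by gcongr
  have b2 : ‖(N : ℂ) ^ (1 - s) / (s - 1)‖ ≤ 1 / |t| := by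
    rw [norm_div, norm_natCast_cpow_of_pos hN1]
    refine div_le_div₀ zero_le_one ?_ (abs_pos.2 ht0) ?_
    · refine Real.rpow_le_one_of_one_le_of_nonpos hN1' ?_
      simp [hre]; linarith
    · have := Complex.abs_im_le_norm (s - 1)
      simpa [hsdef] using this
  have b3 : ‖s‖ / σ * (N : ℝ) ^ (-σ) ≤ 2 := by
    have h2 : (N : ℝ) ^ (-σ) ≤ 1 / N := by
      rw [one_div, ← Real.rpow_neg_one]
      exact Real.rpow_le_rpow_of_exponent_le hN1' (by linarith)
    calc ‖s‖ / σ * (N : ℝ) ^ (-σ) ≤ (1 + δ) * (1 / N) := by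
          refine mul_le_mul ((norm_add_mul_I_div_le hσ t).trans (by linarith)) h2
            (by positivity) (by linarith)
      _ ≤ 2 := by
          rw [mul_one_div, div_le_iff₀ hN0]; linarith
  set A := ∑ n ∈ Finset.range N, 1 / ((n : ℂ) + 1) ^ s
  set B := (N : ℂ) ^ (1 - s) / (s - 1)
  calc ‖riemannZeta s‖ = ‖(riemannZeta s - A - B) + A + B‖ := by congr 1; ring
    _ ≤ ‖riemannZeta s - A - B‖ + ‖A‖ + ‖B‖ := norm_add₃_le
    _ ≤ _ := by linarith

lemma le_norm_riemannZeta {σ : ℝ} (hσ : 1 < σ) (t : ℝ) :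
    1 / (σ - 1 + |t|) - 1 ≤ ‖riemannZeta (σ + t * I)‖ := by
  set s : ℂ := σ + t * I with hsdef
  have hre : s.re = σ := by simp [hsdef]
  have hs : 1 < s.re := by rwa [hre]
  have h := norm_riemannZeta_sub_le hs one_pos
  rw [hre] at h
  have hs1 : s - 1 ≠ 0 := fun h => by
    have := congrArg Complex.re h
    simp [hre] at this; linarith
  have hn : ‖s - 1‖ ≤ σ - 1 + |t| := by
    have : s - 1 = ((σ - 1 : ℝ) : ℂ) + t * I := by rw [hsdef]; push_cast; ring
    rw [this]
    refine (norm_add_le _ _).trans_eq ?_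
    rw [Complex.norm_real, norm_mul, Complex.norm_real, Complex.norm_I, mul_one,
      Real.norm_of_nonneg (by linarith), Real.norm_eq_abs]
  have hsσ : 1 ≤ ‖s‖ / σ := by
    rw [le_div_iff₀ (by linarith), one_mul]
    calc σ ≤ |s.re| := by rw [hre]; exact le_abs_self _
      _ ≤ ‖s‖ := Complex.abs_re_le_norm s
  have hs1n : 1 ≤ ‖s‖ := hsσ.trans (div_le_self (norm_nonneg _) hσ.le)
  have e : riemannZeta s = (riemannZeta s - ∑ n ∈ Finset.range 1, 1 / ((n : ℂ) + 1) ^ s -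
      ((1 : ℕ) : ℂ) ^ (1 - s) / (s - 1)) + s / (s - 1) := by
    simp
    field_simp
    ring
  have h2 : ‖s / (s - 1)‖ - ‖s‖ / σ ≤ ‖riemannZeta s‖ := by
    rw [e]
    rw [Nat.cast_one (R := ℝ), Real.one_rpow, mul_one] at h
    rw [add_comm]
    exact (sub_le_sub_left h _).trans (norm_sub_le_norm_add _ _)
  have hpos : 0 < σ - 1 + |t| := by linarith [abs_nonneg t]
  rcases le_total 1 (σ - 1 + |t|) with hD | hD
  · have : 1 / (σ - 1 + |t|) ≤ 1 := div_le_one_of_le₀ hD hpos.le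
    linarith [norm_nonneg (riemannZeta s)]
  · refine le_trans ?_ h2
    have h3 : 1 ≤ 1 / (σ - 1 + |t|) := by rwa [le_div_iff₀ hpos, one_mul]
    have h4 : 1 / (σ - 1 + |t|) ≤ 1 / ‖s - 1‖ :=
      one_div_le_one_div_of_le (norm_pos_iff.2 hs1) hn
    have h5 : 1 / σ ≤ 1 := div_le_one_of_le₀ hσ.le (by linarith)
    rw [norm_div]
    have e1 : ‖s‖ / ‖s - 1‖ - ‖s‖ / σ = ‖s‖ * (1 / ‖s - 1‖ - 1 / σ) := by ring
    rw [e1]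
    nlinarith

/-- The integral of `g` against the triangle (Fejér) weight on `[-δ, δ]`. -/
noncomputable def triangleIntegral (δ : ℝ) (g : ℝ → ℝ) : ℝ :=
  ∫ t in (-δ)..δ, (1 - |t| / δ) * g t

lemma integral_neg_self_eq_integral_add {F : ℝ → ℝ} {δ : ℝ} (hF : Continuous F) :
    ∫ t in (-δ)..δ, F t = ∫ t in (0 : ℝ)..δ, (F t + F (-t)) := by
  have h1 : ∫ t in (0 : ℝ)..δ, F (-t) = ∫ t in (-δ)..0, F t := by
    rw [intervalIntegral.integral_comp_neg, neg_zero]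
  have hF' : Continuous fun t => F (-t) := hF.comp continuous_neg
  rw [intervalIntegral.integral_add (hF.intervalIntegrable _ _)
    (hF'.intervalIntegrable _ _), h1, add_comm,
    intervalIntegral.integral_add_adjacent_intervals (hF.intervalIntegrable _ _)
    (hF.intervalIntegrable _ _)]

lemma triangleIntegral_eq {δ : ℝ} (hδ : 0 < δ) {g : ℝ → ℝ} (hg : Continuous g) :
    triangleIntegral δ g = ∫ t in (0 : ℝ)..δ, (1 - t / δ) * (g t + g (-t)) := by
  unfold triangleIntegral
  rw [integral_neg_self_eq_integral_add (by fun_prop)]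
  refine intervalIntegral.integral_congr fun t ht => ?_
  rw [Set.uIcc_of_le hδ.le] at ht
  simp only [abs_neg, abs_of_nonneg ht.1]
  ring

lemma triangleIntegral_const_mul (δ c : ℝ) (g : ℝ → ℝ) :
    triangleIntegral δ (fun t => c * g t) = c * triangleIntegral δ g := by
  unfold triangleIntegral
  rw [← intervalIntegral.integral_const_mul]
  congr 1; ext t; ring

lemma triangleIntegral_add (δ : ℝ) {f g : ℝ → ℝ} (hf : Continuous f) (hg : Continuous g) :
    triangleIntegral δ (fun t => f t + g t) = triangleIntegral δ f + triangleIntegral δ g := by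
  unfold triangleIntegral
  rw [← intervalIntegral.integral_add (Continuous.intervalIntegrable (by fun_prop) _ _)
    (Continuous.intervalIntegrable (by fun_prop) _ _)]
  congr 1; ext t; ring

lemma hasSum_triangleIntegral {ι : Type*} [Countable ι] {δ : ℝ} (hδ : 0 < δ) {f : ι → ℝ → ℝ}
    {c : ι → ℝ} {F : ℝ → ℝ} (hf : ∀ i, Continuous (f i)) (hc : Summable c)
    (hfc : ∀ i, ∀ t ∈ Set.Icc (-δ) δ, |f i t| ≤ c i) (hF : ∀ t, HasSum (fun i => f i t) (F t)) :
    HasSum (fun i => triangleIntegral δ (f i)) (triangleIntegral δ F) := by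
  have hle : -δ ≤ δ := by linarith
  refine intervalIntegral.hasSum_integral_of_dominated_convergence (fun i _ => c i) (fun i => ?_)
    (fun i => Eventually.of_forall fun t ht => ?_) (Eventually.of_forall fun t _ => hc)
    intervalIntegrable_const (Eventually.of_forall fun t _ => (hF t).mul_left _)
  · exact Continuous.aestronglyMeasurable (by fun_prop)
  · rw [Set.uIoc_of_le hle] at ht
    have ht' : t ∈ Set.Icc (-δ) δ := Set.Ioc_subset_Icc_self ht
    have h1 : |t| / δ ≤ 1 := div_le_one_of_le₀ (abs_le.2 ht') hδ.le
    have h2 : 0 ≤ |t| / δ := by positivity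
    rw [norm_mul, Real.norm_of_nonneg (by linarith)]
    exact (mul_le_of_le_one_left (norm_nonneg _) (by linarith)).trans (hfc i t ht')

lemma triangleIntegral_cos_nonneg {δ : ℝ} (hδ : 0 < δ) (μ : ℝ) :
    0 ≤ triangleIntegral δ fun t => Real.cos (μ * t) := by
  rw [triangleIntegral_eq hδ (by fun_prop)]
  rcases eq_or_ne μ 0 with rfl | hμ
  · refine intervalIntegral.integral_nonneg hδ.le fun t ht => ?_
    have : t / δ ≤ 1 := div_le_one_of_le₀ ht.2 hδ.le
    simp only [zero_mul, Real.cos_zero]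
    nlinarith
  · have hd : ∀ t, HasDerivAt
        (fun t => 2 * ((1 - t / δ) * (Real.sin (μ * t) / μ) - Real.cos (μ * t) / (δ * μ ^ 2)))
        ((1 - t / δ) * (Real.cos (μ * t) + Real.cos (μ * -t))) t := by
      intro t
      have e0 : HasDerivAt (fun t : ℝ => μ * t) μ t := by
        simpa using (hasDerivAt_id t).const_mul μ
      have e1 := (((hasDerivAt_id t).div_const δ).const_sub 1).mul (e0.sin.div_const μ)
      refine ((e1.sub (e0.cos.div_const (δ * μ ^ 2))).const_mul 2).congr_deriv ?_
      simp only [mul_neg, Real.cos_neg, id]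
      field_simp
      ring
    rw [intervalIntegral.integral_eq_sub_of_hasDerivAt (fun t _ => hd t)
      (Continuous.intervalIntegrable (by fun_prop) _ _)]
    simp only [div_self hδ.ne', sub_self, zero_mul, mul_zero, Real.sin_zero, Real.cos_zero, zero_div,
      zero_sub]
    have : Real.cos (μ * δ) / (δ * μ ^ 2) ≤ 1 / (δ * μ ^ 2) := by
      gcongr
      exact Real.cos_le_one _
    linarith

/-- `Majorized δ g G` says that the Fourier coefficients of `G` against the triangle weight
dominate those of `g`. -/
def Majorized_s7 (δ : ℝ) (g G : ℝ → ℝ) : Prop :=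
  Continuous g ∧ Continuous G ∧ ∀ μ θ : ℝ,
    |triangleIntegral δ fun t => g t * Real.cos (μ * t + θ)| ≤
      triangleIntegral δ fun t => G t * Real.cos (μ * t)

lemma majorized_one {δ : ℝ} (hδ : 0 < δ) : Majorized_s7 δ (fun _ => 1) fun _ => 1 := by
  refine ⟨continuous_const, continuous_const, fun μ θ => ?_⟩
  simp only [one_mul]
  have h : (triangleIntegral δ fun t => Real.cos (μ * t + θ)) =
      Real.cos θ * triangleIntegral δ fun t => Real.cos (μ * t) := by
    rw [triangleIntegral_eq hδ (by fun_prop), triangleIntegral_eq hδ (by fun_prop),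
      ← intervalIntegral.integral_const_mul]
    congr 1; ext t
    simp only [Real.cos_add, mul_neg, Real.cos_neg, Real.sin_neg]
    ring
  rw [h, abs_mul, abs_of_nonneg (triangleIntegral_cos_nonneg hδ μ)]
  exact mul_le_of_le_one_left (triangleIntegral_cos_nonneg hδ μ) (Real.abs_cos_le_one θ)

lemma Majorized_s7.mul_cos_series {ι : Type*} [Countable ι] {δ : ℝ} (hδ : 0 < δ) {g G : ℝ → ℝ}
    (h : Majorized_s7 δ g G) {b l φ : ι → ℝ} (hb : ∀ i, 0 ≤ b i) (hbs : Summable b) {f F : ℝ → ℝ}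
    (hfc : Continuous f) (hFc : Continuous F)
    (hf : ∀ t, HasSum (fun i => b i * Real.cos (l i * t + φ i)) (f t))
    (hF : ∀ t, HasSum (fun i => b i * Real.cos (l i * t)) (F t)) :
    Majorized_s7 δ (fun t => f t * g t) fun t => F t * G t := by
  obtain ⟨hg, hG, h⟩ := h
  refine ⟨hfc.mul hg, hFc.mul hG, fun μ θ => ?_⟩
  obtain ⟨C, hC⟩ := isCompact_Icc.exists_bound_of_continuousOn (s := Set.Icc (-δ) δ) hg.continuousOn
  obtain ⟨D, hD⟩ := isCompact_Icc.exists_bound_of_continuousOn (s := Set.Icc (-δ) δ) hG.continuousOn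
  have s1 := hasSum_triangleIntegral hδ (c := fun i => b i * C)
    (f := fun i t => b i * Real.cos (l i * t + φ i) * g t * Real.cos (μ * t + θ))
    (fun i => by fun_prop) (hbs.mul_right C) (fun i t ht => by
      rw [abs_mul, abs_mul, abs_mul, abs_of_nonneg (hb i)]
      calc b i * |Real.cos (l i * t + φ i)| * |g t| * |Real.cos (μ * t + θ)|
          ≤ b i * 1 * |g t| * 1 := by
            have := hb i
            gcongr <;> exact Real.abs_cos_le_one _
        _ ≤ b i * C := by
            rw [mul_one, mul_one]
            exact mul_le_mul_of_nonneg_left (hC t ht) (hb i))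
    (fun t => ((hf t).mul_right (g t)).mul_right (Real.cos (μ * t + θ)))
  have s2 := hasSum_triangleIntegral hδ (c := fun i => b i * D)
    (f := fun i t => b i * Real.cos (l i * t) * G t * Real.cos (μ * t))
    (fun i => by fun_prop) (hbs.mul_right D) (fun i t ht => by
      rw [abs_mul, abs_mul, abs_mul, abs_of_nonneg (hb i)]
      calc b i * |Real.cos (l i * t)| * |G t| * |Real.cos (μ * t)|
          ≤ b i * 1 * |G t| * 1 := by
            have := hb i
            gcongr <;> exact Real.abs_cos_le_one _
        _ ≤ b i * D := by
            rw [mul_one, mul_one]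
            exact mul_le_mul_of_nonneg_left (hD t ht) (hb i))
    (fun t => ((hF t).mul_right (G t)).mul_right (Real.cos (μ * t)))
  refine HasSum.norm_le_of_bounded s1 s2 fun i => ?_
  have e1 : (fun t => b i * Real.cos (l i * t + φ i) * g t * Real.cos (μ * t + θ)) = fun t =>
      b i / 2 * (g t * Real.cos ((μ + l i) * t + (θ + φ i)) +
        g t * Real.cos ((μ - l i) * t + (θ - φ i))) := by
    ext t
    have a1 : (μ + l i) * t + (θ + φ i) = (μ * t + θ) + (l i * t + φ i) := by ring
    have a2 : (μ - l i) * t + (θ - φ i) = (μ * t + θ) - (l i * t + φ i) := by ring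
    rw [a1, a2, Real.cos_add (μ * t + θ), Real.cos_sub (μ * t + θ)]
    ring
  have e2 : (fun t => b i * Real.cos (l i * t) * G t * Real.cos (μ * t)) = fun t =>
      b i / 2 * (G t * Real.cos ((μ + l i) * t) + G t * Real.cos ((μ - l i) * t)) := by
    ext t
    rw [add_mul, sub_mul, Real.cos_add, Real.cos_sub]
    ring
  rw [e1, e2, triangleIntegral_const_mul, triangleIntegral_const_mul,
    triangleIntegral_add _ (by fun_prop) (by fun_prop),
    triangleIntegral_add _ (by fun_prop) (by fun_prop), norm_mul,
    Real.norm_of_nonneg (by have := hb i; positivity)]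
  refine mul_le_mul_of_nonneg_left ?_ (by have := hb i; positivity)
  exact (abs_add_le _ _).trans (add_le_add (h _ _) (h _ _))

lemma Majorized_s7.pow_cos_series {ι : Type*} [Countable ι] {δ : ℝ} (hδ : 0 < δ)
    {b l φ : ι → ℝ} (hb : ∀ i, 0 ≤ b i) (hbs : Summable b) {f F : ℝ → ℝ}
    (hfc : Continuous f) (hFc : Continuous F)
    (hf : ∀ t, HasSum (fun i => b i * Real.cos (l i * t + φ i)) (f t))
    (hF : ∀ t, HasSum (fun i => b i * Real.cos (l i * t)) (F t)) (n : ℕ) :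
    Majorized_s7 δ (fun t => f t ^ n) fun t => F t ^ n := by
  induction n with
  | zero => simpa using majorized_one hδ
  | succ n ih =>
    simp only [pow_succ']
    exact ih.mul_cos_series hδ hb hbs hfc hFc hf hF

lemma hasSum_triangleIntegral_exp {δ : ℝ} (hδ : 0 < δ) {f : ℝ → ℝ} (hf : Continuous f) (p : ℝ) :
    HasSum (fun n : ℕ => p ^ n / n.factorial * triangleIntegral δ fun t => f t ^ n)
      (triangleIntegral δ fun t => Real.exp (p * f t)) := by
  obtain ⟨C, hC⟩ := isCompact_Icc.exists_bound_of_continuousOn (s := Set.Icc (-δ) δ) hf.continuousOn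
  have h := hasSum_triangleIntegral hδ (f := fun (n : ℕ) t => p ^ n / n.factorial * f t ^ n)
    (c := fun n => (|p| * C) ^ n / n.factorial) (F := fun t => Real.exp (p * f t))
    (fun n => by fun_prop) (Real.summable_pow_div_factorial _) (fun n t ht => by
      rw [abs_mul, abs_div, abs_pow, abs_pow, Nat.abs_cast, div_mul_eq_mul_div, ← mul_pow]
      have := hC t ht
      rw [Real.norm_eq_abs] at this
      gcongr) fun t => by
      have h := NormedSpace.expSeries_div_hasSum_exp (p * f t)
      rw [← Real.exp_eq_exp_ℝ] at h
      refine h.congr_fun fun n => ?_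
      rw [mul_pow, mul_div_right_comm]
  refine h.congr_fun fun n => ?_
  exact (triangleIntegral_const_mul δ _ _).symm

/-- Majorant principle for exponentials of cosine series with nonnegative coefficients. -/
lemma triangleIntegral_exp_le {ι : Type*} [Countable ι] {δ : ℝ} (hδ : 0 < δ)
    {b l φ : ι → ℝ} (hb : ∀ i, 0 ≤ b i) (hbs : Summable b) {f F : ℝ → ℝ}
    (hfc : Continuous f) (hFc : Continuous F)
    (hf : ∀ t, HasSum (fun i => b i * Real.cos (l i * t + φ i)) (f t))
    (hF : ∀ t, HasSum (fun i => b i * Real.cos (l i * t)) (F t)) (p : ℝ) :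
    (triangleIntegral δ fun t => Real.exp (p * f t)) ≤
      triangleIntegral δ fun t => Real.exp (|p| * F t) := by
  refine (le_abs_self _).trans (HasSum.norm_le_of_bounded (hasSum_triangleIntegral_exp hδ hfc p)
    (hasSum_triangleIntegral_exp hδ hFc |p|) fun n => ?_)
  have h := (Majorized_s7.pow_cos_series hδ hb hbs hfc hFc hf hF n).2.2 0 0
  simp only [zero_mul, add_zero, Real.cos_zero, mul_one] at h
  rw [norm_mul, norm_div, norm_pow, Real.norm_eq_abs, Real.norm_natCast]
  exact mul_le_mul_of_nonneg_left h (by positivity)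

/-- The integral of `‖ζ‖ ^ p` over the segment of length `δ` from `σ + iT` upwards. -/
noncomputable def zetaMoment (p δ σ T : ℝ) : ℝ :=
  ∫ t in T..(T + δ), ‖riemannZeta (σ + t * I)‖ ^ p

lemma zetaMoment_eq {σ : ℝ} (hσ : 1 < σ) (p δ T : ℝ) :
    zetaMoment p δ σ T = ∫ t in (0 : ℝ)..δ, Real.exp (p * logZeta σ (T + t)) := by
  rw [intervalIntegral.integral_comp_add_left (fun t => Real.exp (p * logZeta σ t)), add_zero]
  simp only [zetaMoment, norm_riemannZeta_rpow hσ]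

lemma continuous_exp_mul_logZeta {σ : ℝ} (hσ : 1 < σ) (p : ℝ) :
    Continuous fun t => Real.exp (p * logZeta σ t) :=
  Real.continuous_exp.comp ((continuous_logZeta hσ).const_mul p)

lemma integral_le_two_mul_triangleIntegral {δ : ℝ} (hδ : 0 < δ) {g : ℝ → ℝ} (hg : Continuous g)
    (hg0 : ∀ t, 0 ≤ g t) :
    ∫ t in (-(δ / 2))..(δ / 2), g t ≤ 2 * triangleIntegral δ g := by
  rw [← triangleIntegral_const_mul]
  unfold triangleIntegral
  have hi : ∀ a b, IntervalIntegrable (fun t => (1 - |t| / δ) * (2 * g t)) volume a b :=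
    fun a b => Continuous.intervalIntegrable (by fun_prop) _ _
  have h0 : ∀ c t, |t| ≤ c * δ → |t| / δ ≤ c := fun c t h => (div_le_iff₀ hδ).2 h
  refine (intervalIntegral.integral_mono_on (by linarith) (hg.intervalIntegrable _ _) (hi _ _)
    fun t ht => ?_).trans (intervalIntegral.integral_mono_interval (by linarith) (by linarith)
      (by linarith) ?_ (hi _ _))
  · have := h0 (1 / 2) t ((abs_le.2 ht).trans (by linarith))
    nlinarith [hg0 t]
  · refine (ae_restrict_iff' measurableSet_Ioc).2 (Eventually.of_forall fun t ht => ?_)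
    have := h0 1 t ((abs_le.2 (Set.Ioc_subset_Icc_self ht)).trans (by linarith))
    exact mul_nonneg (by linarith) (mul_nonneg two_pos.le (hg0 t))

lemma norm_riemannZeta_rpow_le {σ q δ t : ℝ} (hσ : 1 < σ) (hq0 : 0 ≤ q) (hq1 : q < 1)
    (ht0 : t ≠ 0) (ht : |t| ≤ δ) :
    ‖riemannZeta (σ + t * I)‖ ^ q ≤ |t| ^ (-q) + (3 + Real.log (1 + δ)) := by
  have hδ : 0 ≤ δ := (abs_nonneg t).trans ht
  have hL : 0 ≤ Real.log (1 + δ) := Real.log_nonneg (by linarith)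
  calc ‖riemannZeta (σ + t * I)‖ ^ q
      ≤ (1 / |t| + (3 + Real.log (1 + δ))) ^ q :=
        Real.rpow_le_rpow (norm_nonneg _) (norm_riemannZeta_le hσ ht0 ht) hq0
    _ ≤ (1 / |t|) ^ q + (3 + Real.log (1 + δ)) ^ q :=
        Real.rpow_add_le_add_rpow (by positivity) (by positivity) hq0 hq1.le
    _ ≤ _ := by
        refine add_le_add ?_ ?_
        · rw [one_div, Real.inv_rpow (abs_nonneg t), Real.rpow_neg (abs_nonneg t)]
        · calc (3 + Real.log (1 + δ)) ^ q ≤ (3 + Real.log (1 + δ)) ^ (1 : ℝ) :=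
                Real.rpow_le_rpow_of_exponent_le (by linarith) hq1.le
            _ = _ := Real.rpow_one _

lemma triangleIntegral_exp_logZeta_le {σ q δ : ℝ} (hσ : 1 < σ) (hq0 : 0 ≤ q) (hq1 : q < 1)
    (hδ : 0 < δ) : (triangleIntegral δ fun t => Real.exp (q * logZeta σ t)) ≤
      2 * (δ ^ (1 - q) / (1 - q)) + δ * (3 + Real.log (1 + δ)) := by
  have hL : 0 ≤ Real.log (1 + δ) := Real.log_nonneg (by linarith)
  have hc := continuous_exp_mul_logZeta hσ q
  rw [triangleIntegral_eq hδ hc]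
  have i1 : IntervalIntegrable (fun t : ℝ => 2 * t ^ (-q)) volume 0 δ :=
    (intervalIntegral.intervalIntegrable_rpow' (by linarith)).const_mul 2
  have i2 : IntervalIntegrable (fun t : ℝ => (1 - t / δ) * (2 * (3 + Real.log (1 + δ))))
    volume 0 δ := Continuous.intervalIntegrable (by fun_prop) _ _
  have e2 : ∫ t in (0 : ℝ)..δ, (1 - t / δ) * (2 * (3 + Real.log (1 + δ))) =
      δ * (3 + Real.log (1 + δ)) := by
    rw [intervalIntegral.integral_mul_const, intervalIntegral.integral_sub
      (by simp) (Continuous.intervalIntegrable (by fun_prop) _ _),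
      intervalIntegral.integral_div, integral_id, intervalIntegral.integral_const]
    simp only [smul_eq_mul]
    field_simp
    ring
  have e1 : ∫ t in (0 : ℝ)..δ, 2 * t ^ (-q) = 2 * (δ ^ (1 - q) / (1 - q)) := by
    rw [intervalIntegral.integral_const_mul, integral_rpow (Or.inl (by linarith)),
      Real.zero_rpow (by linarith), sub_zero, neg_add_eq_sub]
  rw [← e1, ← e2, ← intervalIntegral.integral_add i1 i2]
  have hc' : Continuous fun t => Real.exp (q * logZeta σ (-t)) := hc.comp continuous_neg
  refine intervalIntegral.integral_mono_on_of_le_Ioo hδ.le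
    (Continuous.intervalIntegrable (by fun_prop) _ _) (i1.add i2) fun t ht => ?_
  have hle : ∀ s, |s| = t → Real.exp (q * logZeta σ s) ≤ t ^ (-q) + (3 + Real.log (1 + δ)) := by
    intro s hs
    rw [← norm_riemannZeta_rpow hσ, ← hs]
    refine norm_riemannZeta_rpow_le hσ hq0 hq1 (fun h => ?_) (hs.trans_le ht.2.le)
    rw [h, abs_zero] at hs
    exact ht.1.ne hs
  have a1 := hle t (abs_of_pos ht.1)
  have a2 := hle (-t) (by rw [abs_neg, abs_of_pos ht.1])
  have a3 : t / δ ≤ 1 := div_le_one_of_le₀ ht.2.le hδ.le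
  have a4 : 0 ≤ t / δ := div_nonneg ht.1.le hδ.le
  have a5 : 0 ≤ t ^ (-q) := Real.rpow_nonneg ht.1.le _
  have a6 : (1 - t / δ) * (Real.exp (q * logZeta σ t) + Real.exp (q * logZeta σ (-t))) ≤
      (1 - t / δ) * (2 * (t ^ (-q) + (3 + Real.log (1 + δ)))) :=
    mul_le_mul_of_nonneg_left (by linarith) (by linarith)
  nlinarith [mul_nonneg a4 a5]

lemma zetaMoment_le {p δ σ : ℝ} (hp : |p| < 1) (hδ : 0 < δ) (hσ : 1 < σ) (T : ℝ) :
    zetaMoment p δ σ T ≤ 4 * (δ ^ (1 - |p|) / (1 - |p|)) + 2 * δ * (3 + Real.log (1 + δ)) := by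
  have hc : Continuous fun t => Real.exp (p * logZeta σ (t + (T + δ / 2))) :=
    (continuous_exp_mul_logZeta hσ p).comp (continuous_id.add continuous_const)
  have h1 : zetaMoment p δ σ T =
      ∫ t in (-(δ / 2))..(δ / 2), Real.exp (p * logZeta σ (t + (T + δ / 2))) := by
    rw [intervalIntegral.integral_comp_add_right (fun t => Real.exp (p * logZeta σ t))]
    simp only [zetaMoment, norm_riemannZeta_rpow hσ]
    congr 1 <;> ring
  have h2 := integral_le_two_mul_triangleIntegral hδ hc fun t => (Real.exp_pos _).le
  have h3 := triangleIntegral_exp_le hδ (b := logZetaCoeff σ) (l := logZetaFreq)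
    (φ := fun i => logZetaFreq i * (T + δ / 2)) (logZetaCoeff_nonneg σ)
    (summable_logZetaCoeff hσ)
    (f := fun t => logZeta σ (t + (T + δ / 2))) (F := logZeta σ)
    ((continuous_logZeta hσ).comp (continuous_id.add continuous_const)) (continuous_logZeta hσ)
    (fun t => by simpa only [mul_add] using hasSum_logZeta hσ (t + (T + δ / 2)))
    (fun t => hasSum_logZeta hσ t) p
  have h4 := triangleIntegral_exp_logZeta_le hσ (abs_nonneg p) hp hδ
  linarith

lemma tendsto_zetaMoment (p δ : ℝ) {T : ℝ} (hT : 0 < T) (hδ : 0 < δ) {σ : ℝ} (hσ : 1 ≤ σ) :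
    Tendsto (fun s => zetaMoment p δ s T) (nhdsWithin σ (Set.Ioi σ)) (nhds (zetaMoment p δ σ T)) := by
  have hmem : ∀ s t : ℝ, 1 ≤ (((max s 1 : ℝ) : ℂ) + ((max t T : ℝ) : ℂ) * I).re := fun s t => by
    simp
  have hc : Continuous fun x : ℝ × ℝ =>
      ‖riemannZeta (((max x.1 1 : ℝ) : ℂ) + ((max x.2 T : ℝ) : ℂ) * I)‖ ^ p := by
    refine Continuous.rpow_const (continuous_norm.comp ?_) fun x => Or.inl
      (norm_ne_zero_iff.2 (riemannZeta_ne_zero_of_one_le_re (hmem _ _)))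
    refine continuous_iff_continuousAt.2 fun x => ContinuousAt.comp (g := riemannZeta)
      (differentiableAt_riemannZeta fun h => ?_).continuousAt (by fun_prop)
    have := congrArg Complex.im h
    simp only [add_im, ofReal_im, mul_im, ofReal_re, I_im, I_re, one_im] at this
    have := le_max_right x.2 T
    linarith
  have h := (intervalIntegral.continuous_parametric_intervalIntegral_of_continuous'
    (μ := volume) (f := fun s t : ℝ =>
      ‖riemannZeta (((max s 1 : ℝ) : ℂ) + ((max t T : ℝ) : ℂ) * I)‖ ^ p) hc T (T + δ)).tendsto σ
  have heq : ∀ s : ℝ, 1 ≤ s → ∫ t in T..(T + δ),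
      ‖riemannZeta (((max s 1 : ℝ) : ℂ) + ((max t T : ℝ) : ℂ) * I)‖ ^ p = zetaMoment p δ s T := by
    intro s hs
    refine intervalIntegral.integral_congr fun t ht => ?_
    rw [Set.uIcc_of_le (by linarith)] at ht
    simp only [max_eq_left hs, max_eq_left ht.1]
  rw [heq σ hσ] at h
  refine (h.mono_left nhdsWithin_le_nhds).congr' ?_
  filter_upwards [self_mem_nhdsWithin] with s hs
  exact heq s (hσ.trans (le_of_lt hs))

lemma zetaMoment_one_le {p δ T : ℝ} (hp : |p| < 1) (hδ : 0 < δ) (hT : 0 < T) :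
    zetaMoment p δ 1 T ≤ 4 * (δ ^ (1 - |p|) / (1 - |p|)) + 2 * δ * (3 + Real.log (1 + δ)) := by
  refine le_of_tendsto (tendsto_zetaMoment p δ hT hδ le_rfl) ?_
  filter_upwards [self_mem_nhdsWithin] with s hs
  exact zetaMoment_le hp hδ hs T

/-- Moving to the right by `ε` averages `log |ζ|` against the Poisson kernel. -/
lemma integral_logZeta_add {σ : ℝ} (hσ : 1 < σ) {ε : NNReal} (hε : 0 < ε) (t : ℝ) :
    ∫ u, logZeta σ (t + u) ∂(ProbabilityTheory.cauchyMeasure 0 ε) = logZeta (σ + ε) t := by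
  have hε' : (0 : ℝ) < ε := hε
  have h := hasSum_integral_of_dominated_convergence (μ := ProbabilityTheory.cauchyMeasure 0 ε)
    (F := fun i u => logZetaCoeff σ i * Real.cos (logZetaFreq i * (t + u)))
    (f := fun u => logZeta σ (t + u)) (fun i _ => logZetaCoeff σ i)
    (fun i => Continuous.aestronglyMeasurable (by fun_prop))
    (fun i => Eventually.of_forall fun u => by
      rw [norm_mul, Real.norm_of_nonneg (logZetaCoeff_nonneg σ i)]
      exact mul_le_of_le_one_right (logZetaCoeff_nonneg σ i) (Real.abs_cos_le_one _))
    (Eventually.of_forall fun _ => summable_logZetaCoeff hσ) (integrable_const _)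
    (Eventually.of_forall fun u => hasSum_logZeta hσ (t + u))
  refine h.unique ((hasSum_logZeta (by linarith : 1 < σ + ε) t).congr_fun fun i => ?_)
  rw [MeasureTheory.integral_const_mul,
    integral_cos_mul_add_cauchyMeasure hε (logZetaFreq_nonneg i), logZetaCoeff_add, mul_assoc]

lemma exp_mul_logZeta_le {σ : ℝ} (hσ : 1 < σ) (p t : ℝ) :
    Real.exp (p * logZeta σ t) ≤ Real.exp (|p| * logZeta σ 0) := by
  refine Real.exp_le_exp.2 ((le_abs_self _).trans ?_)
  rw [abs_mul]
  exact mul_le_mul_of_nonneg_left (abs_logZeta_le hσ t) (abs_nonneg p)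

lemma exp_mul_logZeta_add_le {σ : ℝ} (hσ : 1 < σ) {ε : NNReal} (hε : 0 < ε) (p t : ℝ) :
    Real.exp (p * logZeta (σ + ε) t) ≤
      ∫ u, Real.exp (p * logZeta σ (t + u)) ∂(ProbabilityTheory.cauchyMeasure 0 ε) := by
  have hc : Continuous fun u => logZeta σ (t + u) :=
    (continuous_logZeta hσ).comp (continuous_const.add continuous_id)
  rw [← integral_logZeta_add hσ hε t, ← MeasureTheory.integral_const_mul]
  refine convexOn_exp.map_integral_le (f := fun u => p * logZeta σ (t + u))
    Real.continuous_exp.continuousOn isClosed_univ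
    (Eventually.of_forall fun _ => Set.mem_univ _) ?_ ?_
  · refine Integrable.const_mul (Integrable.of_bound hc.aestronglyMeasurable (logZeta σ 0) ?_) p
    exact Eventually.of_forall fun u => abs_logZeta_le hσ _
  · refine Integrable.of_bound (Real.continuous_exp.comp
      (hc.const_mul p)).aestronglyMeasurable (Real.exp (|p| * logZeta σ 0)) ?_
    refine Eventually.of_forall fun u => ?_
    rw [Function.comp_apply, Real.norm_of_nonneg (Real.exp_pos _).le]
    exact exp_mul_logZeta_le hσ p _

lemma zetaMoment_nonneg (p σ T : ℝ) {δ : ℝ} (hδ : 0 < δ) : 0 ≤ zetaMoment p δ σ T :=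
  intervalIntegral.integral_nonneg (by linarith) fun _ _ => Real.rpow_nonneg (norm_nonneg _) _

lemma continuous_zetaMoment {σ : ℝ} (hσ : 1 < σ) (p δ : ℝ) :
    Continuous fun T => zetaMoment p δ σ T := by
  simp only [zetaMoment_eq hσ]
  exact intervalIntegral.continuous_parametric_intervalIntegral_of_continuous'
    (f := fun T t => Real.exp (p * logZeta σ (T + t)))
    ((continuous_exp_mul_logZeta hσ p).comp continuous_add) 0 δ

lemma zetaMoment_add_le {p δ σ : ℝ} (hδ : 0 < δ) (hσ : 1 < σ) {ε : NNReal} (hε : 0 < ε) (T : ℝ) :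
    zetaMoment p δ (σ + ε) T ≤
      ∫ u, zetaMoment p δ σ (T + u) ∂(ProbabilityTheory.cauchyMeasure 0 ε) := by
  have hε' : (0 : ℝ) < ε := hε
  have hσε : 1 < σ + ε := by linarith
  have hc := continuous_exp_mul_logZeta hσ p
  have hi : Integrable (Function.uncurry fun t u => Real.exp (p * logZeta σ (T + t + u)))
      ((volume.restrict (Set.uIoc 0 δ)).prod (ProbabilityTheory.cauchyMeasure 0 ε)) := by
    have : IsFiniteMeasure (volume.restrict (Set.uIoc 0 δ)) := ⟨by simp [Set.uIoc]⟩
    refine Integrable.of_bound (Continuous.aestronglyMeasurable ?_)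
      (Real.exp (|p| * logZeta σ 0)) (Eventually.of_forall fun x => ?_)
    · exact hc.comp (by fun_prop : Continuous fun x : ℝ × ℝ => T + x.1 + x.2)
    · simp only [Function.uncurry]
      rw [Real.norm_of_nonneg (Real.exp_pos _).le]
      exact exp_mul_logZeta_le hσ p _
  have hswap := MeasureTheory.intervalIntegral_integral_swap hi
  have e : ∀ u, zetaMoment p δ σ (T + u) =
      ∫ t in (0 : ℝ)..δ, Real.exp (p * logZeta σ (T + t + u)) := fun u => by
    rw [zetaMoment_eq hσ]
    simp only [add_right_comm]
  simp only [e]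
  rw [← hswap, zetaMoment_eq hσε]
  refine intervalIntegral.integral_mono_on hδ.le (Continuous.intervalIntegrable
    ((continuous_exp_mul_logZeta hσε p).comp (continuous_const.add continuous_id)) _ _) ?_
    fun t _ => exp_mul_logZeta_add_le hσ hε p _
  rw [intervalIntegrable_iff]
  exact hi.integral_prod_left

/-- If the moments on the line `Re s = 1` are eventually at most `S`, then so are, up to an
arbitrarily small error, the moments on any line further to the right. -/
lemma exists_zetaMoment_one_add_le {p δ S T₀ : ℝ} (hp : |p| < 1) (hδ : 0 < δ) (hT₀ : 0 < T₀)
    (hS : ∀ T ≥ T₀, zetaMoment p δ 1 T ≤ S) {ε : ℝ} (hε : 0 < ε) {η : ℝ} (hη : 0 < η) :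
    ∃ T₁, ∀ T ≥ T₁, zetaMoment p δ (1 + ε) T ≤ S + η := by
  lift ε to NNReal using hε.le
  have hε' : 0 < ε := hε
  set κ := ProbabilityTheory.cauchyMeasure 0 ε with hκ
  set M := 4 * (δ ^ (1 - |p|) / (1 - |p|)) + 2 * δ * (3 + Real.log (1 + δ)) with hM
  have hM0 : 0 ≤ M := (zetaMoment_nonneg p 2 0 hδ).trans (zetaMoment_le hp hδ one_lt_two 0)
  have hS0 : 0 ≤ S := (zetaMoment_nonneg p 1 T₀ hδ).trans (hS T₀ le_rfl)
  obtain ⟨K, hK⟩ : ∃ K, M * κ.real (Set.Iic K) ≤ η := by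
    have h := (ProbabilityTheory.tendsto_cdf_atBot κ).const_mul M
    rw [mul_zero] at h
    obtain ⟨K, hK⟩ := (h.eventually_lt_const hη).exists
    exact ⟨K, by rw [← ProbabilityTheory.cdf_eq_real]; exact hK.le⟩
  refine ⟨max (T₀ - K) 1, fun T hTm => ?_⟩
  obtain ⟨hT, hT1⟩ := max_le_iff.1 hTm
  have hT' : ∀ u ∈ Set.Ioi K, T₀ ≤ T + u := fun u hu => by
    have : K < u := hu
    linarith
  have hbd : ∀ σ, 1 < σ → ∀ u, ‖zetaMoment p δ σ (T + u)‖ ≤ M := fun σ hσ u => by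
    rw [Real.norm_of_nonneg (zetaMoment_nonneg p σ _ hδ)]
    exact zetaMoment_le hp hδ hσ _
  have hms : ∀ σ, 1 < σ → ∀ ν : Measure ℝ,
      AEStronglyMeasurable (fun u => zetaMoment p δ σ (T + u)) ν := fun σ hσ ν =>
    ((continuous_zetaMoment hσ p δ).comp (continuous_const.add
      continuous_id)).aestronglyMeasurable
  have hlim : Tendsto (fun σ => ∫ u in Set.Ioi K, zetaMoment p δ σ (T + u) ∂κ)
      (nhdsWithin 1 (Set.Ioi 1)) (nhds (∫ u in Set.Ioi K, zetaMoment p δ 1 (T + u) ∂κ)) := by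
    refine tendsto_integral_filter_of_dominated_convergence (fun _ => M) ?_ ?_
      (integrable_const _) ?_
    · filter_upwards [self_mem_nhdsWithin] with σ hσ using hms σ hσ _
    · filter_upwards [self_mem_nhdsWithin] with σ hσ using Eventually.of_forall (hbd σ hσ)
    · refine (ae_restrict_iff' measurableSet_Ioi).2 (Eventually.of_forall fun u hu => ?_)
      exact tendsto_zetaMoment p δ (hT₀.trans_le (hT' u hu)) hδ le_rfl
  have hlimle : ∫ u in Set.Ioi K, zetaMoment p δ 1 (T + u) ∂κ ≤ S := by
    refine (Real.le_norm_self _).trans ((norm_setIntegral_le_of_norm_le_const (C := S)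
      (measure_lt_top _ _) fun u hu => ?_).trans
      (mul_le_of_le_one_right hS0 measureReal_le_one))
    rw [Real.norm_of_nonneg (zetaMoment_nonneg p 1 _ hδ)]
    exact hS _ (hT' u hu)
  have hleft : Tendsto (fun σ => zetaMoment p δ (σ + ε) T) (nhdsWithin 1 (Set.Ioi 1))
      (nhds (zetaMoment p δ (1 + ε) T)) := by
    refine (tendsto_zetaMoment p δ (by linarith) hδ (by linarith)).comp ?_
    refine tendsto_nhdsWithin_iff.2 ⟨?_, ?_⟩
    · exact ((continuous_add_const (ε : ℝ)).tendsto 1).mono_left nhdsWithin_le_nhds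
    · filter_upwards [self_mem_nhdsWithin] with σ hσ
      exact add_lt_add_left (Set.mem_Ioi.1 hσ) _
  refine (le_of_tendsto_of_tendsto hleft (hlim.add_const η) ?_).trans
    (add_le_add_left hlimle η)
  filter_upwards [self_mem_nhdsWithin] with σ hσ
  refine (zetaMoment_add_le hδ hσ hε' T).trans ?_
  rw [← integral_add_compl (s := Set.Ioi K) measurableSet_Ioi
    (Integrable.of_bound (hms σ hσ κ) M (Eventually.of_forall (hbd σ hσ))), Set.compl_Ioi]
  refine add_le_add_right ((le_abs_self _).trans
    ((norm_setIntegral_le_of_norm_le_const (measure_lt_top _ _) fun u _ => hbd σ hσ u).trans hK)) _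

lemma integral_fourier_haarAddCircle {n : ℤ} (hn : n ≠ 0) :
    ∫ x : UnitAddCircle, fourier n x ∂AddCircle.haarAddCircle = 0 := by
  have h := integral_add_right_eq_self (μ := AddCircle.haarAddCircle (T := 1))
    (fun x : UnitAddCircle => (fourier n x : ℂ)) (((1 : ℝ) / 2 / n : ℝ) : UnitAddCircle)
  simp only [fourier_add_half_inv_index hn one_pos, MeasureTheory.integral_neg] at h
  exact self_eq_neg.1 h.symm

lemma integral_mFourier_pi {d : Type*} [Fintype d] {n : d → ℤ} (hn : n ≠ 0) :
    ∫ x, UnitAddTorus.mFourier n x ∂(Measure.pi fun _ : d => AddCircle.haarAddCircle (T := 1)) =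
      0 := by
  obtain ⟨i, hi⟩ := Function.ne_iff.1 hn
  have h := integral_fintype_prod_eq_prod (μ := fun _ : d => AddCircle.haarAddCircle (T := 1))
    (f := fun i (x : UnitAddCircle) => (fourier (n i) x : ℂ))
  refine h.trans (Finset.prod_eq_zero (Finset.mem_univ i) (integral_fourier_haarAddCircle hi))

/-- The orbit of `0` in the torus under the linear flow with frequencies `l`. -/
noncomputable def torusFlow {d : Type*} (l : d → ℝ) (t : ℝ) : UnitAddTorus d :=
  fun i => ((t * (l i / (2 * π)) : ℝ) : UnitAddCircle)

lemma continuous_torusFlow {d : Type*} (l : d → ℝ) : Continuous (torusFlow l) :=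
  continuous_pi fun _ => (AddCircle.continuous_mk' 1).comp (by fun_prop)

lemma mFourier_torusFlow {d : Type*} [Fintype d] (n : d → ℤ) (l : d → ℝ) (t : ℝ) :
    UnitAddTorus.mFourier n (torusFlow l t) =
      cexp (((∑ i, n i * l i : ℝ) : ℂ) * I * t) := by
  have hpi : (π : ℂ) ≠ 0 := ofReal_ne_zero.2 Real.pi_ne_zero
  simp only [UnitAddTorus.mFourier, ContinuousMap.coe_mk, torusFlow, fourier_coe_apply]
  rw [← Complex.exp_sum]
  congr 1
  push_cast
  rw [Finset.sum_mul, Finset.sum_mul]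
  refine Finset.sum_congr rfl fun i _ => ?_
  field_simp

/-- Weyl equidistribution of a linear flow on the torus with rationally independent frequencies. -/
lemma tendsto_average_torusFlow_mFourier {d : Type*} [Fintype d] {l : d → ℝ}
    (hl : ∀ n : d → ℤ, n ≠ 0 → ∑ i, n i * l i ≠ 0) (T : ℝ) (n : d → ℤ) :
    Tendsto (fun N : ℝ => (N : ℂ)⁻¹ *
        ∫ t in T..(T + N), UnitAddTorus.mFourier n (torusFlow l t)) atTop
      (nhds (∫ x, UnitAddTorus.mFourier n x
        ∂(Measure.pi fun _ : d => AddCircle.haarAddCircle (T := 1)))) := by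
  rcases eq_or_ne n 0 with rfl | hn
  · refine tendsto_const_nhds.congr' ?_
    filter_upwards [eventually_gt_atTop 0] with N hN
    have : (N : ℂ) ≠ 0 := ofReal_ne_zero.2 hN.ne'
    simp [UnitAddTorus.mFourier_zero, this]
  · rw [integral_mFourier_pi hn]
    set L := ∑ i, n i * l i with hL
    have hL0 : (L : ℂ) * I ≠ 0 := mul_ne_zero (ofReal_ne_zero.2 (hl n hn)) I_ne_zero
    simp only [mFourier_torusFlow, ← hL]
    refine squeeze_zero_norm' (a := fun N : ℝ => N⁻¹ * (2 / |L|)) ?_ ?_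
    · filter_upwards [eventually_gt_atTop 0] with N hN
      rw [integral_exp_mul_complex hL0, norm_mul, norm_inv, Complex.norm_real,
        Real.norm_of_nonneg hN.le, norm_div, norm_mul, Complex.norm_I, mul_one, Complex.norm_real,
        Real.norm_eq_abs]
      have h1 : ∀ t : ℝ, ‖cexp (L * I * t)‖ = 1 := fun t => by
        rw [mul_right_comm, ← ofReal_mul, norm_exp_ofReal_mul_I]
      gcongr
      refine (norm_sub_le _ _).trans_eq ?_
      rw [h1, h1]
      norm_num
    · simpa using tendsto_inv_atTop_zero.mul_const (2 / |L|)

lemma tendsto_average_torusFlow {d : Type*} [Fintype d] {l : d → ℝ}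
    (hl : ∀ n : d → ℤ, n ≠ 0 → ∑ i, n i * l i ≠ 0) (T : ℝ) {f : C(UnitAddTorus d, ℂ)}
    (hf : f ∈ Submodule.span ℂ (Set.range UnitAddTorus.mFourier)) :
    Tendsto (fun N : ℝ => (N : ℂ)⁻¹ * ∫ t in T..(T + N), f (torusFlow l t)) atTop
      (nhds (∫ x, f x ∂(Measure.pi fun _ : d => AddCircle.haarAddCircle (T := 1)))) := by
  have hc : ∀ g : C(UnitAddTorus d, ℂ), Continuous fun t => g (torusFlow l t) := fun g =>
    g.continuous.comp (continuous_torusFlow l)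
  have hi : ∀ g : C(UnitAddTorus d, ℂ),
      Integrable g (Measure.pi fun _ : d => AddCircle.haarAddCircle (T := 1)) := fun g =>
    Integrable.of_bound g.continuous.aestronglyMeasurable ‖g‖
      (Eventually.of_forall g.norm_coe_le_norm)
  induction hf using Submodule.span_induction with
  | mem g hg =>
    obtain ⟨n, rfl⟩ := hg
    exact tendsto_average_torusFlow_mFourier hl T n
  | zero => simp
  | add g h _ _ hg hh =>
    simp only [ContinuousMap.add_apply]
    rw [MeasureTheory.integral_add (hi g) (hi h)]
    refine (hg.add hh).congr fun N => ?_
    rw [intervalIntegral.integral_add ((hc g).intervalIntegrable _ _)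
      ((hc h).intervalIntegrable _ _), mul_add]
  | smul c g _ hg =>
    simp only [ContinuousMap.smul_apply, smul_eq_mul]
    rw [MeasureTheory.integral_const_mul]
    refine (hg.const_mul c).congr fun N => ?_
    rw [intervalIntegral.integral_const_mul, mul_left_comm]

/-- Kronecker's theorem: a linear flow on the torus with rationally independent frequencies visits
every nonempty open set at arbitrarily large times. -/
lemma exists_torusFlow_mem {d : Type*} [Fintype d] {l : d → ℝ}
    (hl : ∀ n : d → ℤ, n ≠ 0 → ∑ i, n i * l i ≠ 0) {U : Set (UnitAddTorus d)} (hU : IsOpen U)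
    (hne : U.Nonempty) (T : ℝ) : ∃ t ≥ T, torusFlow l t ∈ U := by
  by_contra! hcon
  obtain ⟨y, hy⟩ := hne
  obtain ⟨f, hf0, hf1, hf⟩ := exists_continuous_zero_one_of_isClosed hU.isClosed_compl
    (isClosed_singleton (x := y)) (Set.disjoint_singleton_right.2 fun h => h hy)
  set μ := Measure.pi fun _ : d => AddCircle.haarAddCircle (T := 1) with hμ
  have hpos : 0 < ∫ x, f x ∂μ :=
    f.continuous.integral_pos_of_hasCompactSupport_nonneg_nonzero
      (HasCompactSupport.of_compactSpace f) (fun x => (hf x).1)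
      (x := y) (by rw [hf1 rfl]; exact one_ne_zero)
  set c := ∫ x, f x ∂μ with hcdef
  let fC : C(UnitAddTorus d, ℂ) := ⟨fun x => (f x : ℂ), by fun_prop⟩
  have hfC : ∫ x, fC x ∂μ = c := integral_ofReal
  have hmem : fC ∈ closure
      ((Submodule.span ℂ (Set.range UnitAddTorus.mFourier) : Submodule ℂ C(UnitAddTorus d, ℂ)) :
        Set C(UnitAddTorus d, ℂ)) := by
    rw [← Submodule.topologicalClosure_coe, UnitAddTorus.span_mFourier_closure_eq_top]
    trivial
  obtain ⟨g, hg, hfg⟩ := Metric.mem_closure_iff.1 hmem (c / 3) (by positivity)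
  have hdist : ∀ x, ‖fC x - g x‖ ≤ c / 3 := fun x =>
    ((fC - g).norm_coe_le_norm x).trans (by rw [← dist_eq_norm]; exact hfg.le)
  have hi : ∀ g : C(UnitAddTorus d, ℂ), Integrable g μ := fun g =>
    Integrable.of_bound g.continuous.aestronglyMeasurable ‖g‖
      (Eventually.of_forall g.norm_coe_le_norm)
  have h1 : ‖∫ x, fC x ∂μ - ∫ x, g x ∂μ‖ ≤ c / 3 := by
    rw [← MeasureTheory.integral_sub (hi _) (hi _)]
    simpa using norm_integral_le_of_norm_le_const (μ := μ) (Eventually.of_forall hdist)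
  have h2 : ‖∫ x, g x ∂μ‖ ≤ c / 3 := by
    refine le_of_tendsto (tendsto_average_torusFlow hl T hg).norm ?_
    filter_upwards [eventually_gt_atTop 0] with N hN
    have h3 : ‖∫ t in T..(T + N), g (torusFlow l t)‖ ≤ c / 3 * |T + N - T| := by
      refine intervalIntegral.norm_integral_le_of_norm_le_const fun t ht => ?_
      rw [Set.uIoc_of_le (by linarith)] at ht
      have h4 : fC (torusFlow l t) = 0 := by
        change ((f (torusFlow l t) : ℝ) : ℂ) = 0
        rw [hf0 (hcon t ht.1.le), Pi.zero_apply, ofReal_zero]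
      simpa [h4] using hdist (torusFlow l t)
    rw [add_sub_cancel_left, abs_of_pos hN] at h3
    rw [norm_mul, norm_inv, Complex.norm_real, Real.norm_of_nonneg hN.le, inv_mul_le_iff₀ hN]
    linarith
  have h5 : ‖(c : ℂ)‖ ≤ c / 3 + c / 3 := by
    rw [← hfC]
    calc ‖∫ x, fC x ∂μ‖ = ‖(∫ x, fC x ∂μ - ∫ x, g x ∂μ) + ∫ x, g x ∂μ‖ := by rw [sub_add_cancel]
      _ ≤ _ := (norm_add_le _ _).trans (add_le_add h1 h2)
  rw [Complex.norm_real, Real.norm_of_nonneg hpos.le] at h5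
  linarith

lemma sum_mul_log_prime_ne_zero {A : Finset Nat.Primes} {n : A → ℤ} (hn : n ≠ 0) :
    ∑ i, n i * Real.log (i : Nat.Primes) ≠ 0 := by
  intro h
  refine hn (funext fun j => ?_)
  have hpos : ∀ m : A → ℕ, ∏ i : A, ((i : Nat.Primes) : ℕ) ^ m i ≠ 0 := fun m =>
    Finset.prod_ne_zero_iff.2 fun i _ => pow_ne_zero _ i.1.2.ne_zero
  have hlog : ∀ m : A → ℕ, Real.log ((∏ i : A, ((i : Nat.Primes) : ℕ) ^ m i : ℕ) : ℝ) =
      ∑ i : A, m i * Real.log (i : Nat.Primes) := fun m => by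
    push_cast
    rw [Real.log_prod fun i _ => by exact_mod_cast pow_ne_zero _ i.1.2.ne_zero]
    simp only [Real.log_pow]
  have heq : ∏ i : A, ((i : Nat.Primes) : ℕ) ^ (n i).toNat =
      ∏ i : A, ((i : Nat.Primes) : ℕ) ^ (-n i).toNat := by
    have h0 : ∀ m : A → ℕ, (0 : ℝ) < ((∏ i : A, ((i : Nat.Primes) : ℕ) ^ m i : ℕ) : ℝ) := fun m =>
      Nat.cast_pos.2 (Nat.pos_of_ne_zero (hpos m))
    refine Nat.cast_injective (R := ℝ) (Real.log_injOn_pos (h0 _) (h0 _) ?_)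
    rw [hlog, hlog, ← sub_eq_zero, ← Finset.sum_sub_distrib, ← h]
    refine Finset.sum_congr rfl fun i _ => ?_
    rw [← sub_mul]
    congr 1
    exact_mod_cast Int.toNat_sub_toNat_neg (n i)
  have hfac : ∀ m : A → ℕ, (∏ i : A, ((i : Nat.Primes) : ℕ) ^ m i).factorization (j : Nat.Primes) =
      m j := fun m => by
    rw [Nat.factorization_prod fun i _ => pow_ne_zero _ i.1.2.ne_zero, Finsupp.finsetSum_apply,
      Finset.sum_eq_single j]
    · simp [Nat.Prime.factorization_self j.1.2]
    · intro i _ hij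
      rw [Nat.factorization_pow, Finsupp.smul_apply, i.1.2.factorization, Finsupp.single_apply,
        if_neg fun h => hij (Subtype.ext (Subtype.ext h)), smul_zero]
    · exact fun h => (h (Finset.mem_univ j)).elim
  have := congrArg (fun k => Nat.factorization k (j : Nat.Primes)) heq
  simp only [hfac] at this
  simp only [Pi.zero_apply]
  omega

/-- At arbitrarily large heights `T`, finitely many of the numbers `p ^ (iT)` with `p` prime are
simultaneously close to a given point of the unit circle. -/
lemma exists_prime_pow_near (A : Finset Nat.Primes) (z : Circle) {η : ℝ} (hη : 0 < η) (T₀ : ℝ) :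
    ∃ T ≥ T₀, ∀ p ∈ A, ‖cexp ((Real.log p * T : ℝ) * I) - z‖ < η := by
  let U : Set (UnitAddTorus A) := {x | ∀ i, ‖(AddCircle.toCircle (x i) : ℂ) - z‖ < η}
  have hU : IsOpen U := by
    simp only [U, Set.ofPred_forall]
    refine isOpen_iInter_of_finite fun i => isOpen_lt ?_ continuous_const
    have : Continuous fun x : UnitAddTorus A => AddCircle.toCircle (x i) :=
      AddCircle.continuous_toCircle.comp (continuous_apply i)
    fun_prop
  obtain ⟨θ, hθ⟩ := (AddCircle.homeomorphCircle one_ne_zero).surjective z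
  obtain ⟨T, hT, h⟩ := exists_torusFlow_mem (l := fun i : A => Real.log (i : Nat.Primes))
    (fun n hn => sum_mul_log_prime_ne_zero hn) hU ⟨fun _ => θ, fun i => by
      rw [← AddCircle.homeomorphCircle_apply one_ne_zero, hθ, sub_self, norm_zero]; exact hη⟩ T₀
  refine ⟨T, hT, fun p hp => ?_⟩
  have h2 := h ⟨p, hp⟩
  simp only [torusFlow, AddCircle.toCircle_apply_mk, Circle.coe_exp] at h2
  convert h2 using 5
  have := Real.pi_ne_zero
  field_simp

lemma norm_pow_sub_pow_le_mul {w s : ℂ} (hw : ‖w‖ = 1) (hs : ‖s‖ = 1) (n : ℕ) :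
    ‖w ^ n - s ^ n‖ ≤ n * ‖w - s‖ := by
  induction n with
  | zero => simp
  | succ n ih =>
    have h : w ^ (n + 1) - s ^ (n + 1) = w * (w ^ n - s ^ n) + (w - s) * s ^ n := by ring
    rw [h]
    refine (norm_add_le _ _).trans ?_
    rw [norm_mul, norm_mul, norm_pow, hw, hs, one_pow]
    push_cast
    linarith

lemma abs_cos_logZetaFreq_sub_le {s : ℝ} (hs : |s| = 1) (i : Nat.Primes × ℕ) (T t : ℝ) :
    |Real.cos (logZetaFreq i * (T + t)) - s ^ (i.2 + 1) * Real.cos (logZetaFreq i * t)| ≤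
      (i.2 + 1) * ‖cexp ((Real.log i.1 * T : ℝ) * I) - s‖ := by
  have h1 : Real.cos (logZetaFreq i * (T + t)) - s ^ (i.2 + 1) * Real.cos (logZetaFreq i * t) =
      ((cexp ((Real.log i.1 * T : ℝ) * I) ^ (i.2 + 1) - (s : ℂ) ^ (i.2 + 1)) *
        cexp ((logZetaFreq i * t : ℝ) * I)).re := by
    rw [sub_mul, ← Complex.exp_nat_mul, ← Complex.exp_add, Complex.sub_re]
    congr 1
    · rw [← Complex.exp_ofReal_mul_I_re]
      congr 2
      simp only [logZetaFreq]
      push_cast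
      ring
    · rw [← ofReal_pow, Complex.re_ofReal_mul, Complex.exp_ofReal_mul_I_re]
  rw [h1]
  refine (Complex.abs_re_le_norm _).trans ?_
  rw [norm_mul, norm_exp_ofReal_mul_I, mul_one]
  have h2 := norm_pow_sub_pow_le_mul (norm_exp_ofReal_mul_I (Real.log i.1 * T))
    (by rw [Complex.norm_real, Real.norm_eq_abs, hs] : ‖(s : ℂ)‖ = 1) (i.2 + 1)
  push_cast at h2 ⊢
  exact h2

/-- Vertical translates of `log |ζ|` approximate its twist by a completely multiplicative sign. -/
lemma exists_logZeta_add_near {σ : ℝ} (hσ : 1 < σ) {s : ℝ} (hs : |s| = 1) {η : ℝ} (hη : 0 < η)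
    (T₀ : ℝ) : ∃ T ≥ T₀, ∀ t G, HasSum (fun i =>
      logZetaCoeff σ i * (s ^ (i.2 + 1) * Real.cos (logZetaFreq i * t))) G →
      |logZeta σ (T + t) - G| ≤ η := by
  have hb := (summable_logZetaCoeff hσ).hasSum
  set Z := ∑' i, logZetaCoeff σ i
  obtain ⟨B, hB⟩ := (hb.eventually (lt_mem_nhds (by linarith : Z - η / 4 < Z))).exists
  set c := ∑ i ∈ B, logZetaCoeff σ i * (i.2 + 1) with hc
  have hc0 : 0 ≤ c := Finset.sum_nonneg fun i _ =>
    mul_nonneg (logZetaCoeff_nonneg σ i) (by positivity)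
  obtain ⟨T, hT, h⟩ := exists_prime_pow_near (B.image Prod.fst)
    ⟨(s : ℂ), by simp [Submonoid.unitSphere, hs]⟩ (η := η / (2 * (c + 1))) (by positivity) T₀
  refine ⟨T, hT, fun t G hG => ?_⟩
  classical
  have hfin : ∀ f : Nat.Primes × ℕ → ℝ,
      HasSum (fun i => if i ∈ B then f i else 0) (∑ i ∈ B, f i) := fun f => by
    have h := hasSum_sum_of_ne_finset_zero (L := .unconditional _)
      (f := fun i => if i ∈ B then f i else 0) (s := B)
      fun i hi => if_neg hi
    rwa [Finset.sum_congr rfl fun i hi => if_pos hi] at h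
  have hbound := ((hfin fun i => logZetaCoeff σ i * (i.2 + 1)).mul_right (η / (2 * (c + 1)))).add
    ((hb.sub (hfin (logZetaCoeff σ))).mul_left 2)
  have hmain := (hasSum_logZeta hσ (T + t)).sub hG
  refine (HasSum.norm_le_of_bounded hmain hbound fun i => ?_).trans ?_
  · have hi := logZetaCoeff_nonneg σ i
    rw [← mul_sub, norm_mul, Real.norm_of_nonneg hi]
    split_ifs with hiB
    · have h1 := abs_cos_logZetaFreq_sub_le hs i T t
      have h2 := (h i.1 (Finset.mem_image_of_mem _ hiB)).le
      rw [sub_self, mul_zero, add_zero, mul_assoc]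
      refine mul_le_mul_of_nonneg_left (h1.trans ?_) hi
      exact mul_le_mul_of_nonneg_left h2 (by positivity)
    · rw [zero_mul, zero_add, sub_zero, mul_comm 2]
      refine mul_le_mul_of_nonneg_left ((norm_sub_le _ _).trans ?_) hi
      rw [norm_mul, norm_pow, Real.norm_eq_abs, Real.norm_eq_abs, Real.norm_eq_abs, hs, one_pow,
        one_mul]
      linarith [Real.abs_cos_le_one (logZetaFreq i * (T + t)),
        Real.abs_cos_le_one (logZetaFreq i * t)]
  · rw [← hc]
    have h1 : c * (η / (2 * (c + 1))) ≤ η / 2 := by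
      rw [mul_div_assoc', div_le_div_iff₀ (by positivity) two_pos]
      nlinarith
    linarith

lemma hasSum_logZetaCoeff {σ : ℝ} (hσ : 1 < σ) : HasSum (logZetaCoeff σ) (logZeta σ 0) := by
  simpa using hasSum_logZeta hσ 0

lemma hasSum_logZetaCoeff_even {σ : ℝ} (hσ : 1 < σ) :
    HasSum (fun i => logZetaCoeff σ i * (1 + (-1) ^ (i.2 + 1))) (logZeta (2 * σ) 0) := by
  let g : Nat.Primes × ℕ → Nat.Primes × ℕ := fun i => (i.1, 2 * i.2 + 1)
  have hg : Function.Injective g := fun i j h => by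
    obtain ⟨h1, h2⟩ := Prod.ext_iff.1 h
    simp only [g] at h1 h2
    exact Prod.ext h1 (by omega)
  refine (hg.hasSum_iff fun i hi => ?_).1
    ((hasSum_logZetaCoeff (by linarith : 1 < 2 * σ)).congr_fun fun i => ?_)
  · have hodd : Odd (i.2 + 1) := by
      rw [← Nat.not_even_iff_odd]
      rintro ⟨m, hm⟩
      exact hi ⟨(i.1, m - 1), Prod.ext rfl (by simp only [g]; omega)⟩
    rw [hodd.neg_one_pow]
    ring
  · have heven : Even (2 * i.2 + 1 + 1) := ⟨i.2 + 1, by ring⟩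
    simp only [Function.comp, g, heven.neg_one_pow, logZetaCoeff]
    push_cast
    rw [show σ * (2 * (i.2 : ℝ) + 1 + 1) = 2 * σ * (i.2 + 1) by ring]
    field_simp
    ring

lemma evenCoeff_nonneg (σ : ℝ) (i : Nat.Primes × ℕ) :
    0 ≤ logZetaCoeff σ i * (1 + (-1) ^ (i.2 + 1)) := by
  refine mul_nonneg (logZetaCoeff_nonneg σ i) ?_
  rcases neg_one_pow_eq_or ℝ (i.2 + 1) with h | h <;> rw [h] <;> norm_num

lemma logZeta_two_zero_le : logZeta 2 0 ≤ Real.log 2 := by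
  rw [Real.le_log_iff_exp_le two_pos, ← norm_riemannZeta_eq_exp one_lt_two]
  simp only [ofReal_zero, zero_mul, add_zero, ofReal_ofNat, riemannZeta_two]
  rw [norm_div, norm_pow, Complex.norm_real, Real.norm_of_nonneg Real.pi_pos.le,
    Complex.norm_ofNat]
  nlinarith [Real.pi_lt_d2, Real.pi_pos]

lemma logZeta_zero_le {σ : ℝ} (hσ : 2 ≤ σ) : logZeta σ 0 ≤ Real.log 2 := by
  refine (hasSum_le (fun i => ?_) (hasSum_logZetaCoeff (by linarith))
    (hasSum_logZetaCoeff one_lt_two)).trans logZeta_two_zero_le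
  have h := logZetaCoeff_add 2 (σ - 2) i
  rw [add_sub_cancel] at h
  rw [h]
  refine mul_le_of_le_one_right (logZetaCoeff_nonneg _ _) (Real.exp_le_one_iff.2 ?_)
  exact neg_nonpos.2 (mul_nonneg (by linarith) (logZetaFreq_nonneg i))

/-- At arbitrarily large heights `|ζ| ^ p` is, up to a constant, as large as `|ζ| ^ |p|` at the
pole. -/
lemma exists_le_mul_logZeta_add {p σ η : ℝ} (hp : |p| ≤ 1) (hσ : 1 < σ) (hη : 0 < η) (T₀ : ℝ) :
    ∃ T ≥ T₀, ∀ t, |p| * logZeta σ t - |p| * Real.log 2 - η ≤ p * logZeta σ (T + t) := by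
  rcases le_total 0 p with hp0 | hp0
  · obtain ⟨T, hT, h⟩ := exists_logZeta_add_near hσ (s := 1) (by simp) hη T₀
    refine ⟨T, hT, fun t => ?_⟩
    have h1 := (abs_le.1 (h t _ (by simpa using hasSum_logZeta hσ t))).1
    rw [abs_of_nonneg hp0] at hp ⊢
    have := Real.log_nonneg one_le_two
    nlinarith
  · obtain ⟨T, hT, h⟩ := exists_logZeta_add_near hσ (s := -1) (by simp) hη T₀
    refine ⟨T, hT, fun t => ?_⟩
    have hsum : Summable fun i => logZetaCoeff σ i * (1 + (-1) ^ (i.2 + 1)) *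
        Real.cos (logZetaFreq i * t) := by
      refine Summable.of_norm_bounded (hasSum_logZetaCoeff_even hσ).summable fun i => ?_
      rw [norm_mul, Real.norm_of_nonneg (evenCoeff_nonneg σ i)]
      exact mul_le_of_le_one_right (evenCoeff_nonneg σ i) (Real.abs_cos_le_one _)
    have hE := HasSum.norm_le_of_bounded hsum.hasSum (hasSum_logZetaCoeff_even hσ) fun i => by
      rw [norm_mul, Real.norm_of_nonneg (evenCoeff_nonneg σ i)]
      exact mul_le_of_le_one_right (evenCoeff_nonneg σ i) (Real.abs_cos_le_one _)
    have hG := hsum.hasSum.sub (hasSum_logZeta hσ t)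
    have h1 := (abs_le.1 (h t _ (hG.congr_fun fun i => by ring))).2
    have h2 := (abs_le.1 hE).2
    have h3 := logZeta_zero_le (by linarith : 2 ≤ 2 * σ)
    rw [abs_of_nonpos hp0] at hp ⊢
    nlinarith

lemma integral_add_rpow_neg {q ε a : ℝ} (hq : q < 1) :
    ∫ t in (0 : ℝ)..a, (ε + t) ^ (-q) = ((ε + a) ^ (1 - q) - ε ^ (1 - q)) / (1 - q) := by
  rw [intervalIntegral.integral_comp_add_left (fun t => t ^ (-q)), add_zero,
    integral_rpow (Or.inl (by linarith)), neg_add_eq_sub]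

lemma rpow_mul_rpow_neg_le_exp_mul_logZeta {q ε t : ℝ} (hq : 0 ≤ q) (hε : 0 < ε) (hε2 : ε < 1 / 2)
    (ht : |t| ≤ 1 / 2) :
    (1 / 2 - ε) ^ q * (ε + |t|) ^ (-q) ≤ Real.exp (q * logZeta (1 + ε) t) := by
  have hσ : 1 < 1 + ε := by linarith
  have hpos : 0 < ε + |t| := by positivity
  rw [← norm_riemannZeta_rpow hσ, Real.rpow_neg hpos.le, ← div_eq_mul_inv,
    ← Real.div_rpow (by linarith) hpos.le]
  refine Real.rpow_le_rpow (div_nonneg (by linarith) hpos.le) ?_ hq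
  refine le_trans ?_ (le_norm_riemannZeta hσ t)
  rw [add_sub_cancel_left, div_sub_one hpos.ne']
  exact div_le_div_of_nonneg_right (by linarith) hpos.le

lemma integral_exp_mul_logZeta_ge {q ε a : ℝ} (hq0 : 0 ≤ q) (hq1 : q < 1) (hε : 0 < ε)
    (hε2 : ε < 1 / 2) (ha0 : 0 ≤ a) (ha : a ≤ 1 / 2) :
    2 * (1 / 2 - ε) ^ q * (((ε + a) ^ (1 - q) - ε ^ (1 - q)) / (1 - q)) ≤
      ∫ t in (-a)..a, Real.exp (q * logZeta (1 + ε) t) := by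
  have hσ : 1 < 1 + ε := by linarith
  have hc := continuous_exp_mul_logZeta hσ q
  have hc' : Continuous fun t => Real.exp (q * logZeta (1 + ε) (-t)) := hc.comp continuous_neg
  rw [integral_neg_self_eq_integral_add hc, ← integral_add_rpow_neg hq1,
    ← intervalIntegral.integral_const_mul]
  refine intervalIntegral.integral_mono_on ha0 ?_ ((hc.add hc').intervalIntegrable _ _)
    fun t ht => ?_
  · refine ContinuousOn.intervalIntegrable (ContinuousOn.mul continuousOn_const
      (ContinuousOn.rpow_const (by fun_prop) fun t ht => Or.inl ?_))
    rw [Set.uIcc_of_le ha0] at ht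
    linarith [ht.1]
  · have h : |t| = t := abs_of_nonneg ht.1
    have h1 := rpow_mul_rpow_neg_le_exp_mul_logZeta hq0 hε hε2 (t := t) (by linarith [ht.2])
    have h2 := rpow_mul_rpow_neg_le_exp_mul_logZeta hq0 hε hε2 (t := -t)
      (by rw [abs_neg]; linarith [ht.2])
    rw [abs_neg] at h2
    rw [h] at h1 h2
    linarith

lemma exists_le_zetaMoment {p δ ε a : ℝ} (hp : |p| < 1) (hε : 0 < ε) (hε2 : ε < 1 / 2)
    (ha0 : 0 ≤ a) (ha : a ≤ 1 / 2) (haδ : 2 * a ≤ δ) (T₀ : ℝ) :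
    ∃ T ≥ T₀, Real.exp (-(|p| * Real.log 2) - ε) *
      (2 * (1 / 2 - ε) ^ |p| * (((ε + a) ^ (1 - |p|) - ε ^ (1 - |p|)) / (1 - |p|))) ≤
        zetaMoment p δ (1 + ε) T := by
  have hσ : 1 < 1 + ε := by linarith
  obtain ⟨T, hT, h⟩ := exists_le_mul_logZeta_add hp.le hσ hε (T₀ + a)
  have hc := continuous_exp_mul_logZeta hσ p
  have hq := continuous_exp_mul_logZeta hσ |p|
  refine ⟨T - a, by linarith, ?_⟩
  calc _ ≤ Real.exp (-(|p| * Real.log 2) - ε) *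
        ∫ t in (-a)..a, Real.exp (|p| * logZeta (1 + ε) t) :=
        mul_le_mul_of_nonneg_left
          (integral_exp_mul_logZeta_ge (abs_nonneg p) hp hε hε2 ha0 ha) (Real.exp_pos _).le
    _ ≤ ∫ t in (-a)..a, Real.exp (p * logZeta (1 + ε) (T + t)) := by
        rw [← intervalIntegral.integral_const_mul]
        refine intervalIntegral.integral_mono_on (by linarith)
          ((hq.const_mul _).intervalIntegrable _ _)
          ((hc.comp (continuous_const.add continuous_id)).intervalIntegrable _ _) fun t _ => ?_
        rw [← Real.exp_add]
        exact Real.exp_le_exp.2 (by linarith [h t])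
    _ = ∫ t in (T - a)..(T + a), Real.exp (p * logZeta (1 + ε) t) := by
        rw [intervalIntegral.integral_comp_add_left
          (fun t => Real.exp (p * logZeta (1 + ε) t)), sub_eq_add_neg]
    _ ≤ ∫ t in (T - a)..(T - a + δ), Real.exp (p * logZeta (1 + ε) t) :=
        intervalIntegral.integral_mono_interval le_rfl (by linarith) (by linarith)
          (Eventually.of_forall fun t => (Real.exp_pos _).le) (hc.intervalIntegrable _ _)
    _ = _ := by simp only [zetaMoment, norm_riemannZeta_rpow hσ]

lemma exp_neg_mul_log_two (q : ℝ) : Real.exp (-(q * Real.log 2)) = 2 ^ (-q) := by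
  rw [Real.rpow_def_of_pos two_pos]
  ring_nf

lemma rpow_div_le_of_zetaMoment_le {p δ S T₀ : ℝ} (hp : |p| < 1) (hδ : 0 < δ) (hT₀ : 0 < T₀)
    (hS : ∀ T ≥ T₀, zetaMoment p δ 1 T ≤ S) :
    2 ^ (-|p|) * (min δ 1 ^ (1 - |p|) / (1 - |p|)) ≤ S := by
  set q := |p| with hq
  have hx : 0 < 1 - q := by linarith
  have hq0 : 0 ≤ q := abs_nonneg p
  set a := min δ 1 / 2 with ha
  have hm : 0 < min δ 1 := lt_min hδ one_pos
  have ha0 : 0 < a := by positivity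
  have hle : ∀ ε, 0 < ε → ε < 1 / 2 → Real.exp (-(q * Real.log 2) - ε) *
      (2 * (1 / 2 - ε) ^ q * (((ε + a) ^ (1 - q) - ε ^ (1 - q)) / (1 - q))) ≤ S + ε := by
    intro ε hε hε2
    obtain ⟨T₁, h₁⟩ := exists_zetaMoment_one_add_le hp hδ hT₀ hS hε hε
    obtain ⟨T, hT, h⟩ := exists_le_zetaMoment hp hε hε2 ha0.le
      (by linarith [min_le_right δ 1]) (by linarith [min_le_left δ 1] : 2 * a ≤ δ) T₁
    exact h.trans (h₁ T hT)
  have hlim : Tendsto (fun ε => Real.exp (-(q * Real.log 2) - ε) *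
      (2 * (1 / 2 - ε) ^ q * (((ε + a) ^ (1 - q) - ε ^ (1 - q)) / (1 - q))))
      (nhdsWithin 0 (Set.Ioi 0)) (nhds (Real.exp (-(q * Real.log 2) - 0) *
      (2 * (1 / 2 - 0) ^ q * (((0 + a) ^ (1 - q) - 0 ^ (1 - q)) / (1 - q))))) := by
    refine Tendsto.mono_left (ContinuousAt.tendsto ?_) nhdsWithin_le_nhds
    have c1 : ContinuousAt (fun ε : ℝ => (1 / 2 - ε) ^ q) 0 :=
      ContinuousAt.rpow_const (by fun_prop) (Or.inr hq0)
    have c2 : ContinuousAt (fun ε : ℝ => (ε + a) ^ (1 - q)) 0 :=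
      ContinuousAt.rpow_const (by fun_prop) (Or.inr hx.le)
    have c3 : ContinuousAt (fun ε : ℝ => ε ^ (1 - q)) 0 :=
      ContinuousAt.rpow_const (by fun_prop) (Or.inr hx.le)
    have c4 : ContinuousAt (fun ε : ℝ => Real.exp (-(q * Real.log 2) - ε)) 0 := by fun_prop
    exact c4.mul ((c1.const_mul 2).mul ((c2.sub c3).div_const _))
  have hlim' : Tendsto (fun ε : ℝ => S + ε) (nhdsWithin 0 (Set.Ioi 0)) (nhds (S + 0)) :=
    Tendsto.mono_left (ContinuousAt.tendsto (by fun_prop)) nhdsWithin_le_nhds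
  have h := le_of_tendsto_of_tendsto hlim hlim' (by
    filter_upwards [Ioo_mem_nhdsGT (by norm_num : (0 : ℝ) < 1 / 2)] with ε hε
    exact hle ε hε.1 hε.2)
  rw [add_zero] at h
  refine le_of_eq_of_le ?_ h
  rw [sub_zero, sub_zero, zero_add, Real.zero_rpow hx.ne', sub_zero, exp_neg_mul_log_two, ha,
    Real.div_rpow hm.le two_pos.le, Real.div_rpow one_pos.le two_pos.le, Real.one_rpow,
    Real.rpow_sub two_pos 1 q, Real.rpow_one]
  have : (2 : ℝ) ^ q ≠ 0 := (Real.rpow_pos_of_pos two_pos q).ne'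
  field_simp

lemma mul_le_of_zetaMoment_le {p δ S T₀ : ℝ} (hp : |p| < 1) (hδ : 0 < δ) (hT₀ : 0 < T₀)
    (hS : ∀ T ≥ T₀, zetaMoment p δ 1 T ≤ S) : 2 ^ (-|p|) * δ ≤ S := by
  refine le_of_forall_pos_le_add fun η hη => ?_
  obtain ⟨T, hT⟩ := exists_zetaMoment_one_add_le hp hδ hT₀ hS one_pos hη
  refine le_trans ?_ (hT T le_rfl)
  rw [show (1 : ℝ) + 1 = 2 by norm_num]
  have hc := continuous_exp_mul_logZeta one_lt_two p
  calc 2 ^ (-|p|) * δ = ∫ t in T..(T + δ), Real.exp (-(|p| * Real.log 2)) := by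
        rw [intervalIntegral.integral_const, exp_neg_mul_log_two, smul_eq_mul]
        ring
    _ ≤ ∫ t in T..(T + δ), Real.exp (p * logZeta 2 t) := by
        refine intervalIntegral.integral_mono_on (by linarith) (by simp)
          (hc.intervalIntegrable _ _) fun t _ => Real.exp_le_exp.2 ?_
        have h1 : |p * logZeta 2 t| ≤ |p| * Real.log 2 := by
          rw [abs_mul]
          exact mul_le_mul_of_nonneg_left ((abs_logZeta_le one_lt_two t).trans
            logZeta_two_zero_le) (abs_nonneg p)
        exact (abs_le.1 h1).1
    _ = _ := by simp only [zetaMoment, norm_riemannZeta_rpow one_lt_two]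

lemma three_tenths_le_two_rpow_mul_rpow {x : ℝ} (hx : 0 < x) :
    0.3 ≤ (2 : ℝ) ^ (-(1 - x)) * x ^ x := by
  have h1 : (2 : ℝ) ^ (-(1 - x)) * x ^ x = (1 / 2) * (2 * x) ^ x := by
    rw [Real.mul_rpow two_pos.le hx.le, neg_sub, Real.rpow_sub two_pos, Real.rpow_one]
    ring
  have h2 : Real.log (1 / (2 * x)) ≤ 1 / (2 * x) - 1 := Real.log_le_sub_one_of_pos (by positivity)
  have h3 : -(1 / 2) ≤ Real.log (2 * x) * x := by
    rw [one_div, Real.log_inv] at h2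
    have h4 : (2 * x)⁻¹ * x = 1 / 2 := by field_simp
    nlinarith
  have h5 : Real.exp (-(1 / 2)) ≤ (2 * x) ^ x := by
    rw [Real.rpow_def_of_pos (by positivity)]
    exact Real.exp_le_exp.2 h3
  have h6 : (0.6 : ℝ) ≤ Real.exp (-(1 / 2)) := by
    have h7 : Real.exp (-(1 / 2)) * Real.exp (-(1 / 2)) = (Real.exp 1)⁻¹ := by
      rw [← Real.exp_add, ← Real.exp_neg]
      norm_num
    have h8 : (0.36 : ℝ) ≤ (Real.exp 1)⁻¹ := by
      rw [le_inv_comm₀ (by norm_num) (Real.exp_pos 1)]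
      exact Real.exp_one_lt_d9.le.trans (by norm_num)
    nlinarith [Real.exp_pos (-(1 / 2))]
  rw [h1]
  linarith

lemma three_tenths_mul_le {q δ S : ℝ} (hq0 : 0 ≤ q) (hq1 : q < 1) (hδ : 0 < δ)
    (h1 : 2 ^ (-q) * (min δ 1 ^ (1 - q) / (1 - q)) ≤ S) (h2 : 2 ^ (-q) * δ ≤ S) :
    0.3 * δ ^ (1 - q) / (1 - q) ≤ S := by
  have hx : 0 < 1 - q := by linarith
  have hr := three_tenths_le_two_rpow_mul_rpow hx
  rw [sub_sub_cancel] at hr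
  have h2q : (0 : ℝ) < 2 ^ (-q) := Real.rpow_pos_of_pos two_pos _
  have hxx : (1 - q) ^ (1 - q) ≤ 1 := Real.rpow_le_one hx.le (by linarith) hx.le
  have hδx : 0 < δ ^ (1 - q) := Real.rpow_pos_of_pos hδ _
  rw [mul_div_assoc]
  rcases le_total δ 1 with hδ1 | hδ1
  · rw [min_eq_left hδ1] at h1
    refine le_trans (mul_le_mul_of_nonneg_right ?_ (by positivity)) h1
    nlinarith
  · rw [min_eq_right hδ1, Real.one_rpow] at h1
    calc 0.3 * (δ ^ (1 - q) / (1 - q))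
        ≤ 2 ^ (-q) * (1 - q) ^ (1 - q) * (δ ^ (1 - q) / (1 - q)) :=
          mul_le_mul_of_nonneg_right hr (by positivity)
      _ = 2 ^ (-q) * ((1 / (1 - q)) ^ q * δ ^ (1 - q)) := by
          rw [Real.rpow_sub hx 1 q, Real.rpow_one, one_div, Real.inv_rpow hx.le]
          have : (1 - q) ^ q ≠ 0 := (Real.rpow_pos_of_pos hx q).ne'
          field_simp
      _ ≤ 2 ^ (-q) * max (1 / (1 - q)) δ := by
          have hm : 0 < max (1 / (1 - q)) δ := lt_max_of_lt_right hδ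
          refine mul_le_mul_of_nonneg_left ?_ h2q.le
          calc (1 / (1 - q)) ^ q * δ ^ (1 - q)
              ≤ max (1 / (1 - q)) δ ^ q * max (1 / (1 - q)) δ ^ (1 - q) := by
                gcongr
                · exact le_max_left _ _
                · exact le_max_right _ _
            _ = _ := by rw [← Real.rpow_add hm, add_sub_cancel, Real.rpow_one]
      _ ≤ S := by
          rcases le_total (1 / (1 - q)) δ with h | h
          · rwa [max_eq_right h]
          · rwa [max_eq_left h]

theorem stmt_7 (p : ℝ) (hp1 : -1 < p) (hp2 : p < 1) (δ : ℝ) (hδ : 0 < δ) :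
    ((0.3 * δ ^ (1 - |p|) / (1 - |p|) : ℝ) : EReal) ≤
      Filter.limsup (fun T : ℝ =>
        ((∫ t in T..(T + δ), ‖riemannZeta (1 + t * Complex.I)‖ ^ p : ℝ) : EReal))
        Filter.atTop ∧
    Filter.limsup (fun T : ℝ =>
        ((∫ t in T..(T + δ), ‖riemannZeta (1 + t * Complex.I)‖ ^ p : ℝ) : EReal))
        Filter.atTop ≤
      ((12 * δ ^ (1 - |p|) / (1 - |p|) + 6 * δ * (1 + Real.log (1 + δ)) : ℝ) : EReal) := by
  have hp : |p| < 1 := abs_lt.2 ⟨hp1, hp2⟩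
  have hmoment : ∀ T : ℝ, ∫ t in T..(T + δ), ‖riemannZeta (1 + t * Complex.I)‖ ^ p =
      zetaMoment p δ 1 T := fun T => by simp only [zetaMoment, ofReal_one]
  simp only [hmoment]
  refine ⟨?_, ?_⟩
  · by_contra! hlt
    obtain ⟨S, hS1, hS2⟩ := EReal.lt_iff_exists_real_btwn.1 hlt
    obtain ⟨T₀, hT₀⟩ := eventually_atTop.1 (eventually_lt_of_limsup_lt hS1)
    have hS : ∀ T ≥ max T₀ 1, zetaMoment p δ 1 T ≤ S := fun T hT =>
      (EReal.coe_lt_coe_iff.1 (hT₀ T ((le_max_left _ _).trans hT))).le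
    have hpos : 0 < max T₀ 1 := lt_max_of_lt_right one_pos
    exact (EReal.coe_lt_coe_iff.1 hS2).not_ge (three_tenths_mul_le (abs_nonneg p) hp hδ
      (rpow_div_le_of_zetaMoment_le hp hδ hpos hS) (mul_le_of_zetaMoment_le hp hδ hpos hS))
  · refine limsup_le_of_le (by isBoundedDefault) ?_
    filter_upwards [eventually_gt_atTop 0] with T hT
    refine EReal.coe_le_coe_iff.2 ((zetaMoment_one_le hp hδ hT).trans ?_)
    have hx : 0 < 1 - |p| := by linarith
    have h1 : 0 ≤ δ ^ (1 - |p|) / (1 - |p|) := by positivity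
    have h2 : 0 ≤ Real.log (1 + δ) := Real.log_nonneg (by linarith)
    rw [mul_div_assoc]
    nlinarith [mul_nonneg hδ.le h2]
end
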